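/- arXiv:2112.14874 — 5 statements merged into one kernel-verified Lean document; each statement's English description precedes it below -/
import Mathlib

section
/- Let α ≥ β ≥ −1/2 be real numbers with 2α and 2β integers. For any constants r > 1, n_0 ∈ ℕ and ε ∈ (0, π], there exist a continuous function g_ε : [0, π] → ℝ and a positive constant M (depending only on r, α, β, n_0, not on ε) such that: (i) g_ε(0) = 1 and g_ε(π) = 0; (ii) the Jacobi coefficients satisfy b_n^{(α,β)}(g_ε) = 0 for all 0 ≤ n < n_0; and (iii) |b_n^{(α,β)}(g_ε)| ≤ M ε (1 + n ε)^{−r} for all n ∈ ℕ₀. -/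
/-- The Jacobi polynomial `P_n^{(α,β)}`. -/
noncomputable def jacobiP (α β : ℝ) (n : ℕ) (x : ℝ) : ℝ :=
  Real.Gamma (α + n + 1) / (n.factorial * Real.Gamma (α + β + n + 1)) *
    ∑ k ∈ Finset.range (n + 1),
      (n.choose k : ℝ) * (Real.Gamma (α + β + n + k + 1) / Real.Gamma (α + k + 1)) *
        ((x - 1) / 2) ^ k

/-- The Jacobi coefficient `b_n^{(α,β)}(g)` of a function `g` on `[0, π]`. -/
noncomputable def jacobiCoeff (α β : ℝ) (n : ℕ) (g : ℝ → ℝ) : ℝ :=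
  (2 * n + α + β + 1) * Real.Gamma (n + α + β + 1) /
      (Real.Gamma (n + β + 1) * Real.Gamma (α + 1)) *
    ∫ x in (0:ℝ)..Real.pi, g x * jacobiP α β n (Real.cos x) *
      Real.sin (x / 2) ^ (2 * α + 1) * Real.cos (x / 2) ^ (2 * β + 1)


lemma altSum (n : ℕ) : ∀ (A B : ℝ), 0 < A → 0 < B →
    ∑ k ∈ Finset.range (n + 1), (-1 : ℝ) ^ k * (n.choose k : ℝ) *
      (Real.Gamma (A + k) / Real.Gamma (B + k))
    = (∏ i ∈ Finset.range n, (B - A + i)) * (Real.Gamma A / Real.Gamma (B + n)) := by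
  induction n with
  | zero => intro A B _ _; simp
  | succ n ih =>
    intro A B hA hB
    have key : ∀ f : ℕ → ℝ, ∑ k ∈ Finset.range (n + 1 + 1), (-1 : ℝ) ^ k * ((n+1).choose k : ℝ) * f k
        = ∑ k ∈ Finset.range (n + 1), (-1 : ℝ) ^ k * (n.choose k : ℝ) * (f k - f (k+1)) := by
      intro f
      rw [Finset.sum_range_succ']
      simp only [Nat.choose_succ_succ, Nat.cast_add, mul_sub, Finset.sum_sub_distrib, mul_add, add_mul,
        Finset.sum_add_distrib]
      have h1 := Finset.sum_range_succ' (fun k => (-1 : ℝ) ^ k * (n.choose k : ℝ) * f k) (n+1)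
      rw [Finset.sum_range_succ] at h1
      simp only [Nat.choose_succ_self, Nat.cast_zero, mul_zero, zero_mul, add_zero] at h1
      rw [h1]
      simp only [pow_succ, Nat.choose_zero_right]
      simp
      ring
    rw [key]
    have h2 : ∀ k : ℕ, Real.Gamma (A + k) / Real.Gamma (B + k) -
        Real.Gamma (A + (k + 1 : ℕ)) / Real.Gamma (B + (k + 1 : ℕ))
        = (B - A) * (Real.Gamma (A + k) / Real.Gamma (B + 1 + k)) := by
      intro k
      have hAk : 0 < A + k := by positivity
      have hBk : 0 < B + k := by positivity
      have e1 : A + ((k + 1 : ℕ) : ℝ) = (A + k) + 1 := by push_cast; ring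
      have e2 : B + ((k + 1 : ℕ) : ℝ) = (B + k) + 1 := by push_cast; ring
      have e3 : B + 1 + (k : ℝ) = (B + k) + 1 := by ring
      rw [e1, e2, e3, Real.Gamma_add_one hAk.ne', Real.Gamma_add_one hBk.ne']
      have := (Real.Gamma_pos_of_pos hBk).ne'
      field_simp
      ring
    simp only [h2]
    have h3 := ih A (B + 1) hA (by linarith)
    have h4 : ∀ k ∈ Finset.range (n+1), (-1 : ℝ) ^ k * (n.choose k : ℝ) * ((B - A) * (Real.Gamma (A + k) / Real.Gamma (B + 1 + k)))
       = (B - A) * ((-1 : ℝ) ^ k * (n.choose k : ℝ) * (Real.Gamma (A + k) / Real.Gamma (B + 1 + k))) := by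
      intros; ring
    rw [Finset.sum_congr rfl h4, ← Finset.mul_sum, h3, Finset.prod_range_succ']
    have e4 : B + ((n + 1 : ℕ) : ℝ) = B + 1 + n := by push_cast; ring
    rw [e4]
    have h5 : ∀ i ∈ Finset.range n, B + 1 - A + (i : ℝ) = B - A + ((i + 1 : ℕ) : ℝ) := by
      intros; push_cast; ring
    rw [Finset.prod_congr rfl h5]
    push_cast
    ring

lemma betaTrig (a b : ℝ) (ha : -1/2 ≤ a) (hb : -1/2 ≤ b) :
    ∫ x in (0:ℝ)..Real.pi, Real.sin (x / 2) ^ (2 * a + 1) * Real.cos (x / 2) ^ (2 * b + 1)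
    = Real.Gamma (a + 1) * Real.Gamma (b + 1) / Real.Gamma (a + b + 2) := by
  have h1 : ∫ u in (0:ℝ)..1, u ^ a * (1 - u) ^ b = Real.Gamma (a + 1) * Real.Gamma (b + 1) / Real.Gamma (a + b + 2) := by
    have h := ProbabilityTheory.beta_eq_betaIntegralReal (a+1) (b+1) (by linarith) (by linarith)
    have e : a + 1 + (b + 1) = a + b + 2 := by ring
    rw [ProbabilityTheory.beta, e] at h
    rw [h, Complex.betaIntegral]
    have h2 : ∫ x in (0:ℝ)..1, (x:ℂ) ^ (((a + 1 : ℝ) : ℂ) - 1) * (1 - (x:ℂ)) ^ (((b+1 : ℝ) : ℂ) - 1)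
        = ∫ x in (0:ℝ)..1, ((x ^ a * (1 - x) ^ b : ℝ) : ℂ) := by
      apply intervalIntegral.integral_congr
      intro x hx
      rw [Set.uIcc_of_le zero_le_one] at hx
      simp only
      push_cast
      rw [Complex.ofReal_cpow hx.1, Complex.ofReal_cpow (by linarith [hx.2])]
      simp
    rw [h2, intervalIntegral.integral_ofReal, Complex.ofReal_re]
  have h3 := intervalIntegral.integral_comp_mul_deriv_of_deriv_nonneg (a := 0) (b := Real.pi)
    (f := fun x => Real.sin (x/2) ^ 2) (f' := fun x => Real.sin (x/2) * Real.cos (x/2))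
    (g := fun u => u ^ a * (1 - u) ^ b) (by fun_prop)
    (by
      intro x _
      have h0 : HasDerivAt (fun y : ℝ => y / 2) (1 / 2) x := (hasDerivAt_id x).div_const 2
      have := (h0.sin).pow 2
      refine this.congr_deriv ?_
      norm_num
      ring)
    (by
      intro x hx
      rw [min_eq_left Real.pi_pos.le, max_eq_right Real.pi_pos.le] at hx
      exact mul_nonneg (Real.sin_nonneg_of_nonneg_of_le_pi (by linarith [hx.1]) (by linarith [hx.1, hx.2]))
        (Real.cos_nonneg_of_neg_pi_div_two_le_of_le (by linarith [hx.1, Real.pi_pos]) (by linarith [hx.1, hx.2])))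
  simp at h3
  rw [← h1, ← h3]
  apply intervalIntegral.integral_congr_Ioo_of_le Real.pi_pos.le
  intro x hx
  have hs : 0 < Real.sin (x/2) := Real.sin_pos_of_pos_of_lt_pi (by linarith [hx.1]) (by linarith [hx.1, hx.2])
  have hc : 0 < Real.cos (x/2) := Real.cos_pos_of_mem_Ioo ⟨by linarith [hx.1, Real.pi_pos], by linarith [hx.1, hx.2]⟩
  have e1 : 1 - Real.sin (x/2) ^ 2 = Real.cos (x/2) ^ 2 := by rw [← Real.cos_sq']
  simp only
  rw [e1, Real.rpow_add hs, Real.rpow_add hc, Real.rpow_one, Real.rpow_one]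
  have e2 := Real.rpow_natCast_mul hs.le 2 a
  have e3 := Real.rpow_natCast_mul hc.le 2 b
  push_cast at e2 e3
  rw [e2, e3]
  ring

noncomputable def jw (α β x : ℝ) : ℝ :=
  Real.sin (x / 2) ^ (2 * α + 1) * Real.cos (x / 2) ^ (2 * β + 1)

lemma jw_cont (α β : ℝ) (ha : -1/2 ≤ α) (hb : -1/2 ≤ β) : Continuous (jw α β) := by
  unfold jw
  exact (Continuous.rpow_const (by fun_prop) (fun x => Or.inr (by linarith))).mul
    (Continuous.rpow_const (by fun_prop) (fun x => Or.inr (by linarith)))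

lemma jacobiP_cont (α β : ℝ) (n : ℕ) : Continuous (fun x => jacobiP α β n (Real.cos x)) := by
  unfold jacobiP
  fun_prop

lemma jw_shift (α β : ℝ) (ha : -1/2 ≤ α) (hb : -1/2 ≤ β) (k m : ℕ) (x : ℝ)
    (hx : x ∈ Set.Icc 0 Real.pi) :
    (Real.sin (x/2) ^ 2) ^ k * (Real.cos (x/2) ^ 2) ^ m * jw α β x = jw (α + k) (β + m) x := by
  have hs : 0 ≤ Real.sin (x/2) := Real.sin_nonneg_of_nonneg_of_le_pi (by linarith [hx.1])
    (by linarith [hx.1, hx.2])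
  have hc : 0 ≤ Real.cos (x/2) := Real.cos_nonneg_of_neg_pi_div_two_le_of_le
    (by linarith [hx.1, Real.pi_pos]) (by linarith [hx.1, hx.2])
  have key : ∀ (y a : ℝ) (j : ℕ), 0 ≤ y → -1/2 ≤ a →
      y ^ (2 * (a + j) + 1) = (y ^ 2) ^ j * y ^ (2 * a + 1) := by
    intro y a j hy ha
    have e : 2 * (a + j) + 1 = ((2 * j : ℕ) : ℝ) + (2 * a + 1) := by push_cast; ring
    rw [e, Real.rpow_add_of_nonneg hy (by positivity) (by linarith), Real.rpow_natCast, pow_mul]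
  unfold jw
  rw [key _ _ _ hs ha, key _ _ _ hc hb]
  ring

lemma moment (α β : ℝ) (ha : -1/2 ≤ α) (hb : -1/2 ≤ β) (n m : ℕ) (hn : 1 ≤ n) :
    ∫ x in (0:ℝ)..Real.pi, jacobiP α β n (Real.cos x) * (Real.cos (x/2) ^ 2) ^ m * jw α β x
    = Real.Gamma (α + n + 1) / (n.factorial * Real.Gamma (α + β + n + 1)) *
      (Real.Gamma (β + m + 1) * ((∏ i ∈ Finset.range n, ((m:ℝ) + 1 - n + i)) *
      (Real.Gamma (α + β + n + 1) / Real.Gamma (α + β + m + n + 2)))) := by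
  have hn' : (1:ℝ) ≤ n := by exact_mod_cast hn
  have h1 : ∀ x ∈ Set.uIcc (0:ℝ) Real.pi,
      jacobiP α β n (Real.cos x) * (Real.cos (x/2) ^ 2) ^ m * jw α β x =
      ∑ k ∈ Finset.range (n+1), (Real.Gamma (α + n + 1) / (n.factorial * Real.Gamma (α + β + n + 1)) *
        ((n.choose k : ℝ) * (Real.Gamma (α + β + n + k + 1) / Real.Gamma (α + k + 1)) * (-1) ^ k))
         * jw (α + k) (β + m) x := by
    intro x hx
    rw [Set.uIcc_of_le Real.pi_pos.le] at hx
    have e : (Real.cos x - 1) / 2 = (-1) * Real.sin (x/2) ^ 2 := by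
      have := Real.cos_sq (x/2)
      have h2 := Real.sin_sq_add_cos_sq (x/2)
      rw [mul_div_cancel₀ x (two_ne_zero)] at this
      linarith
    unfold jacobiP
    rw [e, Finset.mul_sum, Finset.sum_mul, Finset.sum_mul]
    apply Finset.sum_congr rfl
    intro k _
    rw [← jw_shift α β ha hb k m x hx, mul_pow]
    ring
  rw [intervalIntegral.integral_congr h1, intervalIntegral.integral_finsetSum]
  · simp only [intervalIntegral.integral_const_mul]
    have h2 : ∀ k ∈ Finset.range (n+1),
      (Real.Gamma (α + n + 1) / (n.factorial * Real.Gamma (α + β + n + 1)) *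
        ((n.choose k : ℝ) * (Real.Gamma (α + β + n + k + 1) / Real.Gamma (α + k + 1)) * (-1) ^ k))
         * ∫ x in (0:ℝ)..Real.pi, jw (α + k) (β + m) x
      = Real.Gamma (α + n + 1) / (n.factorial * Real.Gamma (α + β + n + 1)) *
        (Real.Gamma (β + m + 1) * ((-1 : ℝ) ^ k * (n.choose k : ℝ) *
        (Real.Gamma (α + β + n + 1 + k) / Real.Gamma (α + β + m + 2 + k)))) := by
      intro k _
      have hk : (0:ℝ) ≤ k := by positivity
      have hm : (0:ℝ) ≤ m := by positivity
      unfold jw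
      rw [betaTrig _ _ (by linarith) (by linarith)]
      have g1 := (Real.Gamma_pos_of_pos (show 0 < α + k + 1 by linarith)).ne'
      have e1 : α + k + (β + m) + 2 = α + β + m + 2 + k := by ring
      have e2 : α + β + n + k + 1 = α + β + n + 1 + k := by ring
      rw [e1, e2]
      have : Real.Gamma (α + β + n + 1 + k) / Real.Gamma (α + k + 1) *
        (Real.Gamma (α + k + 1) * Real.Gamma (β + m + 1) / Real.Gamma (α + β + m + 2 + k))
        = Real.Gamma (β + m + 1) *
          (Real.Gamma (α + β + n + 1 + k) / Real.Gamma (α + β + m + 2 + k)) := by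
        field_simp
      linear_combination (Real.Gamma (α + n + 1) / (n.factorial * Real.Gamma (α + β + n + 1)) *
        (n.choose k : ℝ) * (-1) ^ k) * this
    rw [Finset.sum_congr rfl h2, ← Finset.mul_sum, ← Finset.mul_sum,
      altSum n _ _ (by linarith) (by linarith [(show (0:ℝ) ≤ m by positivity)])]
    have e3 : α + β + m + 2 + n = α + β + m + n + 2 := by ring
    have e4 : α + β + m + 2 - (α + β + n + 1) = m + 1 - n := by ring
    rw [e3, e4]
  · intro k _
    apply Continuous.intervalIntegrable
    have hk : (0:ℝ) ≤ k := by positivity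
    have hm : (0:ℝ) ≤ m := by positivity
    exact continuous_const.mul (jw_cont _ _ (by linarith) (by linarith))

lemma moment_zero (α β : ℝ) (ha : -1/2 ≤ α) (hb : -1/2 ≤ β) (n m : ℕ) (hn : m < n) :
    ∫ x in (0:ℝ)..Real.pi, jacobiP α β n (Real.cos x) * (Real.cos (x/2) ^ 2) ^ m * jw α β x
    = 0 := by
  rw [moment α β ha hb n m (by omega), Finset.prod_eq_zero (i := n - 1 - m)]
  · simp
  · simp; omega
  · rw [Nat.sub_sub, Nat.cast_sub (by omega)]; push_cast; ring

lemma moment_mixed (α β : ℝ) (ha : -1/2 ≤ α) (hb : -1/2 ≤ β) (n k : ℕ) : ∀ m,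
    (k + m < n → ∫ x in (0:ℝ)..Real.pi, jacobiP α β n (Real.cos x) *
      ((Real.cos x - 1) / 2) ^ k * (Real.cos (x/2) ^ 2) ^ m * jw α β x = 0) ∧
    (k + m = n → ∫ x in (0:ℝ)..Real.pi, jacobiP α β n (Real.cos x) *
      ((Real.cos x - 1) / 2) ^ k * (Real.cos (x/2) ^ 2) ^ m * jw α β x =
      ∫ x in (0:ℝ)..Real.pi, jacobiP α β n (Real.cos x) * (Real.cos (x/2) ^ 2) ^ n * jw α β x) := by
  induction k with
  | zero =>
    intro m
    constructor
    · intro h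
      simpa using moment_zero α β ha hb n m (by omega)
    · intro h
      have : m = n := by omega
      subst this
      simp
  | succ k ih =>
    intro m
    have hc1 := jacobiP_cont α β n
    have hc2 := jw_cont α β ha hb
    have hrec : ∫ x in (0:ℝ)..Real.pi, jacobiP α β n (Real.cos x) *
        ((Real.cos x - 1) / 2) ^ (k+1) * (Real.cos (x/2) ^ 2) ^ m * jw α β x =
        (∫ x in (0:ℝ)..Real.pi, jacobiP α β n (Real.cos x) *
        ((Real.cos x - 1) / 2) ^ k * (Real.cos (x/2) ^ 2) ^ (m+1) * jw α β x) -
        ∫ x in (0:ℝ)..Real.pi, jacobiP α β n (Real.cos x) *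
        ((Real.cos x - 1) / 2) ^ k * (Real.cos (x/2) ^ 2) ^ m * jw α β x := by
      rw [← intervalIntegral.integral_sub
        (Continuous.intervalIntegrable (by fun_prop) _ _) (Continuous.intervalIntegrable (by fun_prop) _ _)]
      apply intervalIntegral.integral_congr
      intro x _
      have e : (Real.cos x - 1) / 2 = Real.cos (x/2) ^ 2 - 1 := by
        have := Real.cos_sq (x/2)
        rw [mul_div_cancel₀ x (two_ne_zero)] at this
        linarith
      simp only
      rw [e]
      ring
    rw [hrec]
    constructor
    · intro h
      rw [(ih (m+1)).1 (by omega), (ih m).1 (by omega), sub_zero]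
    · intro h
      rw [(ih (m+1)).2 (by omega), (ih m).1 (by omega), sub_zero]

lemma prod_expand (α β : ℝ) (ha : -1/2 ≤ α) (hb : -1/2 ≤ β) (n m : ℕ) :
    ∫ x in (0:ℝ)..Real.pi, jacobiP α β n (Real.cos x) * jacobiP α β m (Real.cos x) * jw α β x
    = Real.Gamma (α + m + 1) / (m.factorial * Real.Gamma (α + β + m + 1)) *
    ∑ k ∈ Finset.range (m + 1),
      (m.choose k : ℝ) * (Real.Gamma (α + β + m + k + 1) / Real.Gamma (α + k + 1)) *
        ∫ x in (0:ℝ)..Real.pi, jacobiP α β n (Real.cos x) *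
        ((Real.cos x - 1) / 2) ^ k * (Real.cos (x/2) ^ 2) ^ 0 * jw α β x := by
  have hc1 := jacobiP_cont α β n
  have hc2 := jw_cont α β ha hb
  simp only [← intervalIntegral.integral_const_mul]
  rw [← intervalIntegral.integral_finsetSum, ← intervalIntegral.integral_const_mul]
  · apply intervalIntegral.integral_congr
    intro x _
    simp only
    conv_lhs => rw [jacobiP.eq_def α β m]
    rw [Finset.mul_sum, Finset.mul_sum, Finset.mul_sum, Finset.sum_mul]
    apply Finset.sum_congr rfl
    intro k _
    ring
  · intro k _
    apply Continuous.intervalIntegrable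
    fun_prop

lemma orth (α β : ℝ) (ha : -1/2 ≤ α) (hb : -1/2 ≤ β) (n m : ℕ) (h : m < n) :
    ∫ x in (0:ℝ)..Real.pi, jacobiP α β n (Real.cos x) * jacobiP α β m (Real.cos x) * jw α β x
    = 0 := by
  rw [prod_expand α β ha hb, Finset.sum_eq_zero, mul_zero]
  intro k hk
  rw [Finset.mem_range] at hk
  rw [(moment_mixed α β ha hb n k 0).1 (by omega), mul_zero]

lemma norm_sq (α β : ℝ) (ha : -1/2 ≤ α) (hb : -1/2 ≤ β) (n : ℕ) (hn : 1 ≤ n) :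
    ∫ x in (0:ℝ)..Real.pi, jacobiP α β n (Real.cos x) * jacobiP α β n (Real.cos x) * jw α β x
    = Real.Gamma (α + n + 1) * Real.Gamma (n + β + 1) /
      (n.factorial * Real.Gamma (α + β + n + 1) * (2 * n + α + β + 1)) := by
  have hn' : (1:ℝ) ≤ n := by exact_mod_cast hn
  rw [prod_expand α β ha hb, Finset.sum_range_succ, Finset.sum_eq_zero, zero_add,
    (moment_mixed α β ha hb n n 0).2 (by omega), moment α β ha hb n n hn]
  · have e1 : ∏ i ∈ Finset.range n, ((n:ℝ) + 1 - n + i) = n.factorial := by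
      rw [← Finset.prod_range_add_one_eq_factorial]
      push_cast
      apply Finset.prod_congr rfl
      intros; ring
    have g1 := (Real.Gamma_pos_of_pos (show 0 < α + n + 1 by linarith)).ne'
    have g2 := (Real.Gamma_pos_of_pos (show 0 < α + β + n + 1 by linarith)).ne'
    have g3 := (Real.Gamma_pos_of_pos (show 0 < α + β + n + n + 1 by linarith)).ne'
    have g4 : 2 * n + α + β + 1 ≠ 0 := by linarith
    have g5 : α + β + n + n + 1 ≠ 0 := by linarith
    have g6 : (n.factorial : ℝ) ≠ 0 := by positivity
    have e2 : Real.Gamma (α + β + n + n + 2) = (2 * n + α + β + 1) * Real.Gamma (α + β + n + n + 1) := by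
      rw [show α + β + n + n + 2 = (α + β + n + n + 1) + 1 by ring, Real.Gamma_add_one g5]
      ring
    rw [e1, e2, Nat.choose_self, show (n:ℝ) + β + 1 = β + n + 1 by ring]
    field_simp
    simp
  · intro k hk
    rw [Finset.mem_range] at hk
    rw [(moment_mixed α β ha hb n k 0).1 (by omega), mul_zero]

lemma jacobiP_one (α β : ℝ) (ha : -1/2 ≤ α) (hb : -1/2 ≤ β) (n : ℕ) (hn : 1 ≤ n) :
    jacobiP α β n 1 = Real.Gamma (α + n + 1) / (n.factorial * Real.Gamma (α + 1)) := by
  have hn' : (1:ℝ) ≤ n := by exact_mod_cast hn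
  unfold jacobiP
  rw [Finset.sum_range_succ', Finset.sum_eq_zero]
  · have g2 := (Real.Gamma_pos_of_pos (show 0 < α + β + n + 1 by linarith)).ne'
    simp
    field_simp
  · intro k _
    simp

lemma jacobiP_one_pos (α β : ℝ) (ha : -1/2 ≤ α) (hb : -1/2 ≤ β) (n : ℕ) (hn : 1 ≤ n) :
    0 < jacobiP α β n 1 := by
  have hn' : (1:ℝ) ≤ n := by exact_mod_cast hn
  rw [jacobiP_one α β ha hb n hn]
  have g1 := (Real.Gamma_pos_of_pos (show 0 < α + n + 1 by linarith))
  have g2 := (Real.Gamma_pos_of_pos (show 0 < α + 1 by linarith))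
  positivity

lemma jacobiP_neg_one (α β : ℝ) (ha : -1/2 ≤ α) (hb : -1/2 ≤ β) (n : ℕ) (hn : 1 ≤ n) :
    ∃ c > 0, jacobiP α β n (-1) = (-1) ^ n * c := by
  have hn' : (1:ℝ) ≤ n := by exact_mod_cast hn
  have h := altSum n (α + β + n + 1) (α + 1) (by linarith) (by linarith)
  have g1 := (Real.Gamma_pos_of_pos (show 0 < α + n + 1 by linarith))
  have g2 := (Real.Gamma_pos_of_pos (show 0 < α + β + n + 1 by linarith))
  have g3 := (Real.Gamma_pos_of_pos (show 0 < α + 1 + n by linarith))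
  have e1 : ∏ i ∈ Finset.range n, (α + 1 - (α + β + n + 1) + (i:ℝ)) =
      (-1) ^ n * ∏ i ∈ Finset.range n, (β + n - i) := by
    have : ∀ i ∈ Finset.range n, α + 1 - (α + β + n + 1) + (i:ℝ) = (-1) * (β + n - i) := by
      intros; ring
    rw [Finset.prod_congr rfl this, Finset.prod_mul_distrib]
    simp
  have hp : 0 < ∏ i ∈ Finset.range n, (β + n - (i:ℝ)) := by
    apply Finset.prod_pos
    intro i hi
    have : (i:ℝ) + 1 ≤ n := by exact_mod_cast Finset.mem_range.1 hi
    linarith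
  refine ⟨Real.Gamma (α + n + 1) / (n.factorial * Real.Gamma (α + β + n + 1)) *
    ((∏ i ∈ Finset.range n, (β + n - (i:ℝ))) *
      (Real.Gamma (α + β + n + 1) / Real.Gamma (α + 1 + n))), by positivity, ?_⟩
  have e2 : ∑ k ∈ Finset.range (n + 1),
      (n.choose k : ℝ) * (Real.Gamma (α + β + n + k + 1) / Real.Gamma (α + k + 1)) *
        ((-1 - 1) / 2) ^ k = ∑ k ∈ Finset.range (n + 1), (-1 : ℝ) ^ k * (n.choose k : ℝ) *
      (Real.Gamma (α + β + n + 1 + k) / Real.Gamma (α + 1 + k)) := by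
    apply Finset.sum_congr rfl
    intro k _
    rw [show α + β + n + k + 1 = α + β + n + 1 + k by ring, show α + k + 1 = α + 1 + k by ring]
    norm_num
    ring
  unfold jacobiP
  rw [e2, h, e1]
  ring

lemma coeff_P (α β : ℝ) (ha : -1/2 ≤ α) (hb : -1/2 ≤ β) (n m : ℕ) (hn : 1 ≤ n) :
    jacobiCoeff α β m (fun x => jacobiP α β n (Real.cos x) / jacobiP α β n 1) =
      if m = n then 1 else 0 := by
  have hn' : (1:ℝ) ≤ n := by exact_mod_cast hn
  have hI : ∫ x in (0:ℝ)..Real.pi, jacobiP α β n (Real.cos x) / jacobiP α β n 1 *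
      jacobiP α β m (Real.cos x) *
      Real.sin (x / 2) ^ (2 * α + 1) * Real.cos (x / 2) ^ (2 * β + 1) =
      (1 / jacobiP α β n 1) * ∫ x in (0:ℝ)..Real.pi,
        jacobiP α β n (Real.cos x) * jacobiP α β m (Real.cos x) * jw α β x := by
    rw [← intervalIntegral.integral_const_mul]
    apply intervalIntegral.integral_congr
    intro x _
    simp only [jw]
    ring
  unfold jacobiCoeff
  rw [hI]
  split_ifs with h
  · subst h
    rw [norm_sq α β ha hb m hn, jacobiP_one α β ha hb m hn]
    have g1 := (Real.Gamma_pos_of_pos (show 0 < α + m + 1 by linarith)).ne'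
    have g2 := (Real.Gamma_pos_of_pos (show 0 < α + β + m + 1 by linarith)).ne'
    have g3 := (Real.Gamma_pos_of_pos (show 0 < m + β + 1 by linarith)).ne'
    have g4 : 2 * m + α + β + 1 ≠ 0 := by linarith
    have g5 := (Real.Gamma_pos_of_pos (show 0 < α + 1 by linarith)).ne'
    have g6 : (m.factorial : ℝ) ≠ 0 := by positivity
    rw [show (m:ℝ) + α + β + 1 = α + β + m + 1 by ring]
    field_simp
  · rcases lt_or_gt_of_ne h with h | h
    · rw [orth α β ha hb n m h]; simp
    · have : ∫ x in (0:ℝ)..Real.pi,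
          jacobiP α β n (Real.cos x) * jacobiP α β m (Real.cos x) * jw α β x = 0 := by
        refine Eq.trans ?_ (orth α β ha hb m n h)
        apply intervalIntegral.integral_congr
        intro x _
        simp only
        ring
      rw [this]; simp

lemma coeff_sum (α β : ℝ) (ha : -1/2 ≤ α) (hb : -1/2 ≤ β) (m : ℕ) (s : Finset ℕ)
    (hs : ∀ n ∈ s, 1 ≤ n) (c : ℕ → ℝ) :
    jacobiCoeff α β m (fun x => ∑ n ∈ s, c n * (jacobiP α β n (Real.cos x) / jacobiP α β n 1)) =
      if m ∈ s then c m else 0 := by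
  have h1 : jacobiCoeff α β m
      (fun x => ∑ n ∈ s, c n * (jacobiP α β n (Real.cos x) / jacobiP α β n 1)) =
      ∑ n ∈ s, c n *
        jacobiCoeff α β m (fun x => jacobiP α β n (Real.cos x) / jacobiP α β n 1) := by
    unfold jacobiCoeff
    simp only [mul_left_comm (c _)]
    rw [← Finset.mul_sum]
    congr 1
    simp only [← intervalIntegral.integral_const_mul]
    rw [← intervalIntegral.integral_finsetSum]
    · apply intervalIntegral.integral_congr
      intro x _
      simp only [Finset.sum_mul]
      apply Finset.sum_congr rfl
      intros; ring
    · intro n _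
      apply Continuous.intervalIntegrable
      have hc1 := jacobiP_cont α β n
      have hc3 := jacobiP_cont α β m
      have hc2 := jw_cont α β ha hb
      have : Continuous (fun x => c n * (jacobiP α β n (Real.cos x) / jacobiP α β n 1 *
        jacobiP α β m (Real.cos x) * jw α β x)) := by fun_prop
      convert this using 2
      simp only [jw]
      ring
  rw [h1]
  have h2 : ∀ n ∈ s, c n *
        jacobiCoeff α β m (fun x => jacobiP α β n (Real.cos x) / jacobiP α β n 1) =
        if m = n then c n else 0 := by
    intro n hn
    rw [coeff_P α β ha hb n m (hs n hn)]
    simp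
  rw [Finset.sum_congr rfl h2, Finset.sum_ite_eq]

lemma exists_bal (s : ℕ → ℝ) (hs : ∀ n, 1 ≤ n → s n * s (n+1) < 0) :
    ∃ a : ℕ → ℝ, ∀ n, 1 ≤ n → 0 ≤ a n ∧ a n ≤ 1 ∧ a n * s n + (1 - a n) * s (n+1) = 0 := by
  refine ⟨fun n => s (n+1) / (s (n+1) - s n), fun n hn => ?_⟩
  have h := hs n hn
  have hne : s (n+1) - s n ≠ 0 := by
    intro h0
    have : s (n+1) = s n := by linarith
    rw [this] at h
    nlinarith [mul_self_nonneg (s n)]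
  refine ⟨?_, ?_, ?_⟩
  · rcases lt_or_gt_of_ne hne with h1 | h1
    · apply div_nonneg_of_nonpos _ h1.le
      by_contra! h2
      nlinarith
    · apply div_nonneg _ h1.le
      by_contra! h2
      nlinarith
  · rcases lt_or_gt_of_ne hne with h1 | h1
    · rw [div_le_one_of_neg h1]
      by_contra! h2
      nlinarith
    · rw [div_le_one h1]
      by_contra! h2
      nlinarith
  · field_simp
    ring

lemma sum_pair (f : ℕ → ℝ) (N : ℕ) :
    ∑ i ∈ Finset.range (2 * N), f i = ∑ j ∈ Finset.range N, (f (2*j) + f (2*j+1)) := by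
  induction N with
  | zero => simp
  | succ N ih =>
    rw [show 2 * (N+1) = 2 * N + 1 + 1 by ring, Finset.sum_range_succ, Finset.sum_range_succ, ih,
      Finset.sum_range_succ]
    ring

/-- Proposition 1, bump function: for α ≥ β ≥ −1/2 with 2α, 2β ∈ ℤ,
any r > 1 and n₀ ∈ ℕ, there is a constant M > 0 (independent of ε) such that for every
ε ∈ (0, π] there is a continuous function g_ε on [0, π] with g_ε(0)=1, g_ε(π)=0, vanishing
Jacobi coefficients below n₀, and |b_n^{(α,β)}(g_ε)| ≤ M ε (1+nε)^{−r}. -/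
theorem stmt1 (α β : ℝ) (hβ : -1/2 ≤ β) (hαβ : β ≤ α)
    (hα2 : ∃ m : ℤ, 2 * α = (m : ℝ)) (hβ2 : ∃ m : ℤ, 2 * β = (m : ℝ))
    (r : ℝ) (hr : 1 < r) (n₀ : ℕ) :
    ∃ M > 0, ∀ ε ∈ Set.Ioc (0:ℝ) Real.pi, ∃ g : ℝ → ℝ,
      ContinuousOn g (Set.Icc 0 Real.pi) ∧
      g 0 = 1 ∧ g Real.pi = 0 ∧
      (∀ n : ℕ, n < n₀ → jacobiCoeff α β n g = 0) ∧
      (∀ n : ℕ, |jacobiCoeff α β n g| ≤ M * ε * (1 + n * ε) ^ (-r)) := by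
  have hα : -1/2 ≤ α := hβ.trans hαβ
  set K : ℝ := 3 * ((n₀ + 2) * Real.pi + 1) with hK
  have hKpos : 0 < K := by have := Real.pi_pos; positivity
  refine ⟨(1 + K) ^ r, by positivity, ?_⟩
  intro ε hε
  obtain ⟨hε0, hεπ⟩ := hε
  obtain ⟨a, ha⟩ := exists_bal (fun n => jacobiP α β n (-1) / jacobiP α β n 1) (by
    intro n hn
    obtain ⟨c, hc, h1⟩ := jacobiP_neg_one α β hα hβ n hn
    obtain ⟨d, hd, h2⟩ := jacobiP_neg_one α β hα hβ (n+1) (by omega)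
    have p1 := jacobiP_one_pos α β hα hβ n hn
    have p2 := jacobiP_one_pos α β hα hβ (n+1) (by omega)
    rw [h1, h2, pow_succ]
    have hsq : ((-1:ℝ) ^ n) * (-1) ^ n = 1 := by rw [← mul_pow]; simp
    have : (-1:ℝ) ^ n * c / jacobiP α β n 1 * ((-1) ^ n * -1 * d / jacobiP α β (n + 1) 1)
      = - (((-1:ℝ) ^ n * (-1) ^ n) * (c / jacobiP α β n 1 * (d / jacobiP α β (n + 1) 1))) := by ring
    rw [this, hsq]
    have : 0 < c / jacobiP α β n 1 * (d / jacobiP α β (n + 1) 1) := by positivity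
    linarith)
  set N : ℕ := n₀ + 1 + ⌈1/ε⌉₊ with hN
  have hN1 : 1 ≤ N := by omega
  have hNpos : (0:ℝ) < N := by exact_mod_cast hN1
  have hNε : 1 / (N:ℝ) ≤ ε := by
    rw [div_le_iff₀ hNpos]
    have h1 : 1 / ε ≤ N := (Nat.le_ceil _).trans (by rw [hN]; push_cast; linarith [(show (0:ℝ) ≤ n₀ by positivity)])
    rw [div_le_iff₀ hε0] at h1
    linarith
  have hNK : 3 * (N:ℝ) * ε ≤ K := by
    have h1 : (⌈1/ε⌉₊ : ℝ) ≤ 1 / ε + 1 := (Nat.ceil_lt_add_one (by positivity)).le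
    have h2 : (N:ℝ) ≤ n₀ + 2 + 1 / ε := by rw [hN]; push_cast; linarith
    have h3 : (N:ℝ) * ε ≤ (n₀ + 2 + 1 / ε) * ε := by gcongr
    have h4 : (n₀ + 2 + 1 / ε) * ε = (n₀ + 2) * ε + 1 := by field_simp
    have h5 : ((n₀:ℝ) + 2) * ε ≤ (n₀ + 2) * Real.pi := by gcongr
    rw [hK]; linarith
  let c : ℕ → ℝ := fun n => (if Even (n - N) then a n else 1 - a (n - 1)) / N
  have hc_even : ∀ j, c (N + 2 * j) = a (N + 2 * j) / N := by
    intro j; simp [c]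
  have hc_odd : ∀ j, c (N + (2 * j + 1)) = (1 - a (N + 2 * j)) / N := by
    intro j
    have : ¬ Even (2 * j + 1) := by simp
    have e : N + (2 * j + 1) - 1 = N + 2 * j := by omega
    simp only [c, Nat.add_sub_cancel_left, if_neg this, e]
  have hc_bd : ∀ n ∈ Finset.Ico N (3 * N), |c n| ≤ 1 / N := by
    intro n hn
    rw [Finset.mem_Ico] at hn
    simp only [c]
    rw [abs_div, abs_of_pos hNpos]
    gcongr
    split_ifs with h
    · obtain ⟨h1, h2, _⟩ := ha n (by omega)
      rw [abs_le]; constructor <;> linarith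
    · have : n ≠ N := by rintro rfl; simp at h
      obtain ⟨h1, h2, _⟩ := ha (n - 1) (by omega)
      rw [abs_le]; constructor <;> linarith
  have hs : ∀ n ∈ Finset.Ico N (3 * N), 1 ≤ n := by
    intro n hn
    rw [Finset.mem_Ico] at hn
    omega
  have hcoeff := fun m => coeff_sum α β hα hβ m (Finset.Ico N (3 * N)) hs c
  refine ⟨fun x => ∑ n ∈ Finset.Ico N (3 * N),
    c n * (jacobiP α β n (Real.cos x) / jacobiP α β n 1), ?_, ?_, ?_, ?_, ?_⟩
  · apply Continuous.continuousOn
    have := jacobiP_cont α β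
    fun_prop
  · simp only [Real.cos_zero]
    rw [Finset.sum_Ico_eq_sum_range, show 3 * N - N = 2 * N by omega, sum_pair]
    have : ∀ j ∈ Finset.range N, c (N + 2 * j) *
        (jacobiP α β (N + 2 * j) 1 / jacobiP α β (N + 2 * j) 1) +
        c (N + (2 * j + 1)) *
        (jacobiP α β (N + (2 * j + 1)) 1 / jacobiP α β (N + (2 * j + 1)) 1) = 1 / N := by
      intro j _
      rw [div_self (jacobiP_one_pos α β hα hβ _ (by omega)).ne',
        div_self (jacobiP_one_pos α β hα hβ _ (by omega)).ne', hc_even, hc_odd]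
      ring
    rw [Finset.sum_congr rfl this]
    simp
    try field_simp
  · simp only [Real.cos_pi]
    rw [Finset.sum_Ico_eq_sum_range, show 3 * N - N = 2 * N by omega, sum_pair]
    apply Finset.sum_eq_zero
    intro j _
    rw [hc_even, hc_odd]
    have h := (ha (N + 2 * j) (by omega)).2.2
    simp only [Nat.add_assoc] at h
    linear_combination h / N
  · intro n hn
    rw [hcoeff, if_neg]
    rw [Finset.mem_Ico]
    omega
  · intro n
    rw [hcoeff]
    split_ifs with h
    · refine (hc_bd n h).trans (hNε.trans ?_)
      rw [Finset.mem_Ico] at h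
      have h1 : (n:ℝ) ≤ 3 * N := by exact_mod_cast h.2.le
      have h2 : (n:ℝ) * ε ≤ K := (mul_le_mul_of_nonneg_right h1 hε0.le).trans hNK
      have h3 : (0:ℝ) < 1 + n * ε := by positivity
      have h4 : (1 + n * ε) ^ r ≤ (1 + K) ^ r := Real.rpow_le_rpow h3.le (by linarith) (by linarith)
      have h5 : 0 < (1 + n * ε) ^ r := Real.rpow_pos_of_pos h3 r
      rw [Real.rpow_neg h3.le, ← div_eq_mul_inv, le_div_iff₀ h5]
      nlinarith
    · rw [abs_zero]
      positivity
end

section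
/- Let α ≥ β ≥ −1/2 be real numbers and let H ∈ (0, 1). Then for every n ∈ ℕ₀ the Jacobi coefficients of the function x ↦ sin^{2H}(x/2) on [0, π] are given by the closed formula b_n^{(α,β)}(sin^{2H}(x/2)) = ((2n+α+β+1) Γ(α+H+1) Γ(n+α+β+1) Γ(n−H)) / (n! Γ(α+1) Γ(α+β+n+H+2) Γ(−H)). -/
noncomputable def poch (x : ℝ) (k : ℕ) : ℝ := ∏ i ∈ Finset.range k, (x + i)

lemma poch_zero (x : ℝ) : poch x 0 = 1 := by simp [poch]
lemma poch_succ (x : ℝ) (k : ℕ) : poch x (k+1) = poch x k * (x + k) := by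
  simp [poch, Finset.prod_range_succ]
lemma poch_succ' (x : ℝ) (k : ℕ) : poch x (k+1) = x * poch (x+1) k := by
  rw [poch, poch, Finset.prod_range_succ', mul_comm]
  simp only [Nat.cast_zero, add_zero]
  congr 1
  apply Finset.prod_congr rfl
  intro i _
  push_cast; ring
lemma poch_pos {x : ℝ} (hx : 0 < x) (k : ℕ) : 0 < poch x k :=
  Finset.prod_pos (fun i _ => by positivity)

lemma Gamma_poch {x : ℝ} (hx : ∀ m : ℕ, x ≠ -m) (k : ℕ) :
    Real.Gamma (x + k) = poch x k * Real.Gamma x := by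
  induction k with
  | zero => simp [poch_zero]
  | succ k ih =>
    have : x + k ≠ 0 := fun h => hx k (by linarith)
    rw [poch_succ, show x + ((k+1 : ℕ):ℝ) = (x + k) + 1 by push_cast; ring,
      Real.Gamma_add_one this, ih]
    ring

lemma Gamma_poch_pos {x : ℝ} (hx : 0 < x) (k : ℕ) :
    Real.Gamma (x + k) = poch x k * Real.Gamma x :=
  Gamma_poch (fun m h => by have : (0:ℝ) ≤ m := m.cast_nonneg
                            linarith) k

noncomputable def tF (s b c d : ℝ) (n k : ℕ) : ℝ :=
  (n.choose k : ℝ) * (-1)^k * poch (s+n) k * poch b k / (poch c k * poch d k)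

lemma tele (s b c d : ℝ) (hc : 0 < c) (hd : 0 < d) (hs : d = s + b - c + 1) (n K : ℕ) :
    ∑ k ∈ Finset.range (K+1), ((c+n)*(d+n)*tF s b c d (n+1) k
      - (s-c+1+n)*(n+c-b)*tF s b c d n k) =
    (s+2*n+1) * (-1)^K * (n.choose K : ℝ) * poch (s+n+1) K * poch b (K+1) /
      (poch c K * poch d K) := by
  induction K with
  | zero =>
    simp [tF, poch_zero, poch_succ, hs]; ring
  | succ K ih =>
    rw [Finset.sum_range_succ, ih]
    have hp := poch_pos hc K
    have hq := poch_pos hd K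
    have h1 : (n.choose (K+1) : ℝ) = (n-K) * n.choose K / (K+1) := by
      rw [eq_div_iff (by positivity)]
      rcases le_or_gt K n with h | h
      · have := Nat.choose_succ_right_eq n K
        have h2 : ((n.choose (K+1) * (K+1) : ℕ):ℝ) = ((n.choose K * (n-K) : ℕ) : ℝ) := by rw [this]
        push_cast [Nat.cast_sub h] at h2
        linarith
      · simp [Nat.choose_eq_zero_of_lt h, Nat.choose_eq_zero_of_lt (Nat.lt_succ_of_lt h)]
    have h3 : ((n+1).choose (K+1) : ℝ) = n.choose K + n.choose (K+1) := by
      exact_mod_cast Nat.choose_succ_succ n K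
    simp only [tF]
    rw [h3, h1]
    rw [poch_succ' (s+n) K, poch_succ b (K+1), poch_succ b K, poch_succ c, poch_succ d,
      show s + ((n+1:ℕ):ℝ) = s+n+1 by push_cast; ring, poch_succ (s+n+1) K]
    have hcK : c + K ≠ 0 := by positivity
    have hdK : d + K ≠ 0 := by positivity
    have hp' := hp.ne'
    have hq' := hq.ne'
    generalize poch c K = C at *
    generalize poch d K = D at *
    generalize poch b K = B at *
    generalize poch (s+n+1) K = A at *
    generalize (n.choose K : ℝ) = ch at *
    have hK : (K:ℝ)+1 ≠ 0 := by positivity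
    have : s = d - b + c - 1 := by linarith
    subst this
    push_cast
    field_simp
    ring

lemma saal (s b c d : ℝ) (hc : 0 < c) (hd : 0 < d) (hs : d = s + b - c + 1) (n : ℕ) :
    ∑ k ∈ Finset.range (n+1), tF s b c d n k =
      poch (s-c+1) n * poch (c-b) n / (poch c n * poch d n) := by
  induction n with
  | zero => simp [tF, poch_zero]
  | succ n ih =>
    have h := tele s b c d hc hd hs n (n+1)
    rw [Finset.sum_sub_distrib, ← Finset.mul_sum, ← Finset.mul_sum,
      Finset.sum_range_succ (fun k => tF s b c d n k) (n+1), ih] at h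
    have h0 : tF s b c d n (n+1) = 0 := by simp [tF]
    rw [h0] at h
    simp only [Nat.choose_succ_self, Nat.cast_zero, mul_zero, zero_mul, zero_div, add_zero] at h
    simp only [poch_succ]
    have hp := (poch_pos hc n).ne'
    have hq := (poch_pos hd n).ne'
    have h1 : (c+n) ≠ 0 := by positivity
    have h2 : (d+n) ≠ 0 := by positivity
    apply mul_left_cancel₀ (mul_ne_zero h1 h2)
    rw [sub_eq_zero.1 h]
    field_simp
    try ring

open MeasureTheory Set in
lemma beta_int (a b : ℝ) (ha : 0 < a) (hb : 0 < b) :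
    ∫ x in (0:ℝ)..Real.pi, Real.sin (x/2) ^ (2*a-1) * Real.cos (x/2) ^ (2*b-1) =
      Real.Gamma a * Real.Gamma b / Real.Gamma (a+b) := by
  have hB := ProbabilityTheory.beta_eq_betaIntegralReal a b ha hb
  rw [ProbabilityTheory.beta] at hB
  have hR : (Complex.betaIntegral a b).re = ∫ t in Ioo (0:ℝ) 1, t^(a-1) * (1-t)^(b-1) := by
    have : Complex.betaIntegral a b = ((∫ t in Ioo (0:ℝ) 1, t^(a-1) * (1-t)^(b-1) : ℝ) : ℂ) := by
      rw [Complex.betaIntegral, intervalIntegral.integral_of_le zero_le_one,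
        integral_Ioc_eq_integral_Ioo, ← integral_complex_ofReal]
      apply setIntegral_congr_fun measurableSet_Ioo
      intro t ht
      simp only []
      rw [Complex.ofReal_mul, Complex.ofReal_cpow ht.1.le, Complex.ofReal_cpow (by linarith [ht.2])]
      push_cast
      rfl
    rw [this, Complex.ofReal_re]
  rw [hB, hR, intervalIntegral.integral_of_le Real.pi_pos.le, integral_Ioc_eq_integral_Ioo]
  have hmono : StrictMonoOn (fun x : ℝ => Real.sin (x/2)^2) (Icc 0 Real.pi) := by
    intro x hx y hy hxy
    have h1 : Real.sin (x/2) < Real.sin (y/2) :=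
      Real.sin_lt_sin_of_lt_of_le_pi_div_two (by linarith [hx.1, Real.pi_pos]) (by linarith [hy.2]) (by linarith)
    have h0 : 0 ≤ Real.sin (x/2) :=
      Real.sin_nonneg_of_nonneg_of_le_pi (by linarith [hx.1]) (by linarith [hx.2, Real.pi_pos])
    simp only []
    gcongr
  have himg : (fun x : ℝ => Real.sin (x/2)^2) '' Ioo 0 Real.pi = Ioo 0 1 := by
    apply subset_antisymm
    · have := hmono.image_Ioo_subset
      simpa using this
    · have := intermediate_value_Ioo (f := fun x : ℝ => Real.sin (x/2)^2) Real.pi_pos.le (by fun_prop)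
      simpa using this
  rw [← himg, integral_image_eq_integral_abs_deriv_smul (f' := fun x => Real.sin (x/2) * Real.cos (x/2)) measurableSet_Ioo _ (hmono.mono Ioo_subset_Icc_self).injOn]
  · apply setIntegral_congr_fun measurableSet_Ioo
    intro x hx
    have hs : 0 < Real.sin (x/2) :=
      Real.sin_pos_of_pos_of_lt_pi (by linarith [hx.1]) (by linarith [hx.2, Real.pi_pos])
    have hc : 0 < Real.cos (x/2) :=
      Real.cos_pos_of_mem_Ioo ⟨by linarith [hx.1, Real.pi_pos], by linarith [hx.2]⟩
    simp only [smul_eq_mul]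
    rw [abs_of_pos (mul_pos hs hc), ← Real.cos_sq', ← Real.rpow_natCast, ← Real.rpow_natCast,
      ← Real.rpow_mul hs.le, ← Real.rpow_mul hc.le,
      show (2*a-1) = ((2:ℕ):ℝ) * (a-1) + 1 by push_cast; ring,
      show (2*b-1) = ((2:ℕ):ℝ) * (b-1) + 1 by push_cast; ring, Real.rpow_add_one hs.ne', Real.rpow_add_one hc.ne']
    ring
  · intro x hx
    have h := (((hasDerivAt_id x).div_const 2).sin).pow 2
    refine HasDerivAt.hasDerivWithinAt (h.congr_deriv ?_)
    simp only [id]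
    push_cast
    ring

lemma jint (α β : ℝ) (hβ : -1/2 ≤ β) (hαβ : β ≤ α) (H : ℝ) (hH : H ∈ Set.Ioo (0:ℝ) 1)
    (n : ℕ) :
    ∫ x in (0:ℝ)..Real.pi, Real.sin (x/2) ^ (2*H) * jacobiP α β n (Real.cos x) *
      Real.sin (x / 2) ^ (2 * α + 1) * Real.cos (x / 2) ^ (2 * β + 1) =
    ∑ k ∈ Finset.range (n + 1), Real.Gamma (α + n + 1) / (n.factorial * Real.Gamma (α + β + n + 1)) *
      ((n.choose k : ℝ) * (Real.Gamma (α + β + n + k + 1) / Real.Gamma (α + k + 1)) * (-1)^k) *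
      (Real.Gamma (H+α+1+k) * Real.Gamma (β+1) / Real.Gamma (H+α+1+k+(β+1))) := by
  have hH0 := hH.1
  have key : ∀ k : ℕ, Real.Gamma (H+α+1+k) * Real.Gamma (β+1) / Real.Gamma (H+α+1+k+(β+1)) =
      ∫ x in (0:ℝ)..Real.pi, Real.sin (x/2) ^ (2*(H+α+1+k)-1) * Real.cos (x/2) ^ (2*(β+1)-1) := by
    intro k
    have : (0:ℝ) ≤ k := k.cast_nonneg
    rw [beta_int _ _ (by linarith) (by linarith)]
  simp_rw [key, ← intervalIntegral.integral_const_mul]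
  rw [← intervalIntegral.integral_finsetSum]
  · rw [intervalIntegral.integral_of_le Real.pi_pos.le, intervalIntegral.integral_of_le Real.pi_pos.le]
    apply MeasureTheory.setIntegral_congr_fun measurableSet_Ioc
    intro x hx
    have hs : 0 < Real.sin (x/2) :=
      Real.sin_pos_of_pos_of_lt_pi (by linarith [hx.1]) (by linarith [hx.2, Real.pi_pos])
    have hcos : (Real.cos x - 1)/2 = - Real.sin (x/2)^2 := by
      have h := Real.cos_sq' (x/2)
      have h2 := Real.cos_two_mul (x/2)
      rw [show 2*(x/2) = x by ring] at h2
      rw [h2, h]; ring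
    simp only [jacobiP]
    rw [hcos, Finset.mul_sum, Finset.mul_sum, Finset.sum_mul, Finset.sum_mul]
    apply Finset.sum_congr rfl
    intro k _
    rw [show 2*(H+α+1+(k:ℝ))-1 = 2*H + (2*α+1) + ((2*k:ℕ):ℝ) by push_cast; ring,
      Real.rpow_add hs _ ((2*k:ℕ):ℝ), Real.rpow_add hs (2*H) (2*α+1), Real.rpow_natCast,
      show 2*(β+1)-1 = 2*β+1 by ring, neg_pow, ← pow_mul]
    ring
  · intro k _
    have : (0:ℝ) ≤ k := k.cast_nonneg
    apply Continuous.intervalIntegrable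
    apply Continuous.mul continuous_const
    apply Continuous.mul
    · exact Continuous.rpow_const (by fun_prop) (fun x => Or.inr (by linarith))
    · exact Continuous.rpow_const (by fun_prop) (fun x => Or.inr (by linarith))

/-- closed formula for the Jacobi coefficients of `x ↦ sin^{2H}(x/2)`. -/
theorem stmt9 (α β : ℝ) (hβ : -1/2 ≤ β) (hαβ : β ≤ α) (H : ℝ) (hH : H ∈ Set.Ioo (0:ℝ) 1)
    (n : ℕ) :
    jacobiCoeff α β n (fun x => Real.sin (x/2) ^ (2*H)) =
      (2*(n:ℝ)+α+β+1) * Real.Gamma (α+H+1) * Real.Gamma ((n:ℝ)+α+β+1) *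
          Real.Gamma ((n:ℝ)-H) /
        ((n.factorial : ℝ) * Real.Gamma (α+1) * Real.Gamma (α+β+(n:ℝ)+H+2) *
          Real.Gamma (-H)) := by
  have hH0 := hH.1
  have hH1 := hH.2
  have hn : (0:ℝ) ≤ n := n.cast_nonneg
  rw [jacobiCoeff, jint α β hβ hαβ H hH n]
  rcases eq_or_ne (α+β+1+n) 0 with h0 | h0
  · have : 2*(n:ℝ)+α+β+1 = 0 := by linarith
    rw [this]; simp
  have hs : 0 < α+β+1+n := lt_of_le_of_ne (by linarith) h0.symm
  have S := saal (α+β+1) (H+α+1) (α+1) (α+β+H+2) (by linarith) (by linarith) (by ring) n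
  have hα1 : 0 < α+1 := by linarith
  have hβ1 : 0 < β+1 := by linarith
  have hHα : 0 < H+α+1 := by linarith
  have hd : 0 < α+β+H+2 := by linarith
  have gs := (Real.Gamma_pos_of_pos hs).ne'
  have gα := (Real.Gamma_pos_of_pos hα1).ne'
  have gβ := (Real.Gamma_pos_of_pos hβ1).ne'
  have gd := (Real.Gamma_pos_of_pos hd).ne'
  have hHm : ∀ m : ℕ, -H ≠ -m := by
    intro m h
    have h1 : H = m := by linarith
    rw [h1] at hH0 hH1
    have h2 : 0 < m := by exact_mod_cast hH0
    have h3 : m < 1 := by exact_mod_cast hH1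
    omega
  have gH := Real.Gamma_ne_zero hHm
  have T : ∀ k ∈ Finset.range (n+1),
      Real.Gamma (α + n + 1) / (n.factorial * Real.Gamma (α + β + n + 1)) *
      ((n.choose k : ℝ) * (Real.Gamma (α + β + n + k + 1) / Real.Gamma (α + k + 1)) * (-1)^k) *
      (Real.Gamma (H+α+1+k) * Real.Gamma (β+1) / Real.Gamma (H+α+1+k+(β+1))) =
      (poch (α+1) n * Real.Gamma (H+α+1) * Real.Gamma (β+1) /
        (n.factorial * Real.Gamma (α+β+H+2))) *
        tF (α+β+1) (H+α+1) (α+1) (α+β+H+2) n k := by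
    intro k _
    have pα := (poch_pos hα1 k).ne'
    have pd := (poch_pos hd k).ne'
    rw [show α + n + 1 = (α+1) + n by ring, show α+β+n+1 = α+β+1+n by ring,
      show α + β + n + k + 1 = (α+β+1+n) + k by ring, show α + k + 1 = (α+1)+k by ring,
      show H+α+1+k+(β+1) = (α+β+H+2)+k by ring, Gamma_poch_pos hα1, Gamma_poch_pos hα1,
      Gamma_poch_pos hs, Gamma_poch_pos hHα, Gamma_poch_pos hd, tF]
    have : (n.factorial : ℝ) ≠ 0 := by positivity
    field_simp
  rw [Finset.sum_congr rfl T, ← Finset.mul_sum, S]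
  have pα := (poch_pos hα1 n).ne'
  have pβ := (poch_pos hβ1 n).ne'
  have pd := (poch_pos hd n).ne'
  have : (n.factorial : ℝ) ≠ 0 := by positivity
  rw [show (n:ℝ)+β+1 = (β+1)+n by ring, show (n:ℝ)-H = -H+n by ring,
    show α+β+(n:ℝ)+H+2 = (α+β+H+2)+n by ring, Gamma_poch_pos hβ1, Gamma_poch hHm,
    Gamma_poch_pos hd, show α+β+1-(α+1)+1 = β+1 by ring, show α+1-(H+α+1) = -H by ring,
    show H+α+1 = α+H+1 by ring]
  field_simp
end

section
/- Let α ≥ β ≥ −1/2 be real numbers, let ν ∈ (0, 2), and set H = ν/2. Consider the function f(x) = 1 − sin^ν(x/2) on [0, π], which is the covariance function of an isotropic Gaussian random field on the compact two-point homogeneous space with Jacobi parameters (α, β). Then its Jacobi coefficients satisfy the asymptotic relation lim_{n→∞} n^{ν+1} · b_n^{(α,β)}(1 − sin^ν(x/2)) = −2 Γ(α+H+1) / (Γ(α+1) Γ(−H)); in particular b_n^{(α,β)}(1 − sin^ν(x/2)) is asymptotically a positive constant times n^{−ν−1}. -/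
open Finset Filter Topology

noncomputable def pch (a : ℝ) (n : ℕ) : ℝ := ∏ j ∈ range n, (a + j)

lemma pch_succ (a : ℝ) (n : ℕ) : pch a (n+1) = pch a n * (a + n) := by
  simp [pch, prod_range_succ]
lemma pch_zero (a : ℝ) : pch a 0 = 1 := by simp [pch]
lemma pch_pos {a : ℝ} (h : 0 < a) (n : ℕ) : 0 < pch a n := by
  unfold pch; exact prod_pos fun j _ => by positivity
lemma Gamma_pch {a : ℝ} (h : 0 < a) (n : ℕ) : Real.Gamma (a + n) = pch a n * Real.Gamma a := by
  induction n with
  | zero => simp [pch]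
  | succ n ih =>
    push_cast
    rw [← add_assoc, Real.Gamma_add_one (by positivity), ih, pch_succ]; ring
lemma pch_shift (a : ℝ) (n : ℕ) : a * pch (a+1) n = pch a n * (a + n) := by
  induction n with
  | zero => simp [pch]
  | succ n ih => rw [pch_succ, pch_succ, ← mul_assoc, ih]; push_cast; ring

noncomputable def tt (α s H : ℝ) (n k : ℕ) : ℝ :=
  (-1)^k * (n.choose k : ℝ) * pch (s+n) k * pch (α+H+1) k / (pch (α+1) k * pch (s+H+1) k)

lemma choose_cast (n m : ℕ) : (n.choose (m+1) : ℝ) = n.choose m * (n - m) / (m+1) := by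
  rw [eq_div_iff (by positivity)]
  rcases le_or_gt m n with h | h
  · rw [← Nat.cast_sub h]; exact_mod_cast Nat.choose_succ_right_eq n m
  · rw [Nat.choose_eq_zero_of_lt h, Nat.choose_eq_zero_of_lt (by omega)]; simp

lemma wz (α s H : ℝ) (hα : 0 < α + 1) (hs : 0 < s + H + 1) (n : ℕ) (hn : 0 < s + n) (m : ℕ) :
    ∑ k ∈ range (m+1), (tt α s H (n+1) k - (n-H)*(n+s-α)/((α+1+n)*(s+H+1+n)) * tt α s H n k)
    = (2*n+s+1)*(s+n+m)*(α+H+1+m)/((s+n)*(α+1+n)*(s+H+1+n)) * tt α s H n m := by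
  have h1 : α + 1 + n ≠ 0 := by positivity
  have h2 : s+H+1+n ≠ 0 := by positivity
  have h3 := hn.ne'
  induction m with
  | zero =>
    simp [tt, pch_zero]
    field_simp
    ring
  | succ m ih =>
    rw [sum_range_succ, ih]
    have e : pch (s + n + 1) m = pch (s+n) m * (s+n+m) / (s+n) := by
      rw [eq_div_iff h3, mul_comm, pch_shift]
    have h4 := (pch_pos hα m).ne'
    have h5 := (pch_pos hs m).ne'
    have h6 : α + 1 + m ≠ 0 := by positivity
    have h7 : s+H+1+m ≠ 0 := by positivity
    have h8 : (m:ℝ) + 1 ≠ 0 := by positivity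
    simp only [tt, pch_succ, Nat.choose_succ_succ, Nat.cast_add, choose_cast, Nat.cast_one, pow_succ, ← add_assoc]
    rw [e]
    generalize pch (s+n) m = A
    generalize pch (α+1) m = B at *
    generalize pch (s+H+1) m = C at *
    field_simp
    ring

lemma saal_s10 (α s H : ℝ) (hα : 0 < α + 1) (hs : 0 < s + H + 1) (hs1 : 0 < s + 1) (n : ℕ) :
    ∑ k ∈ range (n+2), tt α s H (n+1) k
     = pch (-H) (n+1) * pch (s-α) (n+1) / (pch (α+1) (n+1) * pch (s+H+1) (n+1)) := by
  induction n with
  | zero =>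
    simp [tt, pch, sum_range_succ]
    field_simp
    ring
  | succ n ih =>
    have h := wz α s H hα hs (n+1) (by push_cast; linarith [(Nat.cast_nonneg n : (0:ℝ) ≤ n)]) (n+2)
    have z : tt α s H (n+1) (n+2) = 0 := by
      simp [tt]
    rw [sum_sub_distrib, ← mul_sum, sum_range_succ (fun k => tt α s H (n+1) k), z, ih] at h
    rw [show n + 1 + 2 = n + 2 + 1 from rfl, sub_eq_zero.1 (h.trans (mul_zero _))]
    rw [pch_succ _ (n+1), pch_succ _ (n+1), pch_succ _ (n+1), pch_succ _ (n+1)]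
    have h4 := (pch_pos hα (n+1)).ne'
    have h5 := (pch_pos hs (n+1)).ne'
    have h6 : α + 1 + (n+1:ℕ) ≠ 0 := by positivity
    have h7 : s+H+1+(n+1:ℕ) ≠ 0 := by positivity
    field_simp
    ring

lemma pch_lim (a : ℝ) (h : ∀ m : ℕ, a ≠ -m) :
    Tendsto (fun n : ℕ => pch a n * (n:ℝ)^(1-a) / n.factorial) atTop (𝓝 (Real.Gamma a)⁻¹) := by
  have h1 := (Real.GammaSeq_tendsto_Gamma a).inv₀ (Real.Gamma_ne_zero h)
  have h2 : Tendsto (fun n : ℕ => (n:ℝ)/(n + a)) atTop (𝓝 1) := tendsto_natCast_div_add_atTop a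
  have h3 := h1.mul h2
  rw [mul_one] at h3
  refine h3.congr' ?_
  filter_upwards [eventually_gt_atTop 0] with n hn
  have hn' : (0:ℝ) < n := by exact_mod_cast hn
  have e : a + n ≠ 0 := fun e => h n (by linarith)
  have e' : (n:ℝ) + a ≠ 0 := by rwa [add_comm]
  have f := n.factorial_ne_zero
  have : (n.factorial:ℝ) ≠ 0 := by exact_mod_cast f
  have hp := (Real.rpow_pos_of_pos hn' a).ne'
  have hq : ∏ j ∈ range (n+1), (a + (j:ℝ)) = pch a n * (a+n) := by rw [← pch_succ, pch]
  rw [Real.GammaSeq, hq, Real.rpow_sub hn', Real.rpow_one]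
  field_simp
  ring

lemma real_beta {p q : ℝ} (hp : 0 < p) (hq : 0 < q) :
    IntervalIntegrable (fun u : ℝ => u ^ (p-1) * (1-u) ^ (q-1)) MeasureTheory.volume 0 1 ∧
    ∫ u in (0:ℝ)..1, u ^ (p-1) * (1-u) ^ (q-1)
      = Real.Gamma p * Real.Gamma q / Real.Gamma (p+q) := by
  have hc := Complex.betaIntegral_convergent (u := p) (v := q) (by simpa) (by simpa)
  have key : ∀ u ∈ Set.Icc (0:ℝ) 1, (u:ℂ) ^ ((p:ℂ)-1) * (1-(u:ℂ)) ^ ((q:ℂ)-1)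
      = ((u ^ (p-1) * (1-u) ^ (q-1) : ℝ) : ℂ) := by
    intro u hu
    push_cast
    rw [Complex.ofReal_cpow hu.1, Complex.ofReal_cpow (by linarith [hu.2])]
    push_cast; rfl
  have hc2 : IntervalIntegrable (fun u : ℝ => ((u ^ (p-1) * (1-u) ^ (q-1) : ℝ) : ℂ))
      MeasureTheory.volume 0 1 := by
    refine hc.congr ?_
    intro u hu
    rw [Set.uIoc_of_le zero_le_one] at hu
    exact key u ⟨hu.1.le, hu.2⟩
  constructor
  · have := hc2.norm
    refine this.congr ?_
    intro u hu
    rw [Set.uIoc_of_le zero_le_one] at hu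
    have h1 := Real.rpow_nonneg hu.1.le (p-1)
    have h2 := Real.rpow_nonneg (sub_nonneg.2 hu.2) (q-1)
    simp only [Complex.norm_real, Real.norm_eq_abs]
    exact abs_of_nonneg (mul_nonneg h1 h2)
  · have e := ProbabilityTheory.beta_eq_betaIntegralReal p q hp hq
    rw [ProbabilityTheory.beta] at e
    rw [e, Complex.betaIntegral]
    rw [intervalIntegral.integral_congr (g := fun u : ℝ => ((u ^ (p-1) * (1-u) ^ (q-1) : ℝ) : ℂ))]
    · rw [intervalIntegral.integral_ofReal, Complex.ofReal_re]
    · intro u hu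
      rw [Set.uIcc_of_le zero_le_one] at hu
      exact key u hu

lemma trig_cont {a b : ℝ} (ha : 0 ≤ a) (hb : 0 ≤ b) :
    Continuous (fun x : ℝ => Real.sin (x/2) ^ a * Real.cos (x/2) ^ b) := by
  have h1 : Continuous fun x : ℝ => Real.sin (x/2) := by fun_prop
  have h2 : Continuous fun x : ℝ => Real.cos (x/2) := by fun_prop
  exact (h1.rpow_const fun x => Or.inr ha).mul (h2.rpow_const fun x => Or.inr hb)

lemma half_pos' {x : ℝ} (hx : x ∈ Set.Ioo 0 Real.pi) : 0 < Real.sin (x/2) ∧ 0 < Real.cos (x/2) :=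
  ⟨Real.sin_pos_of_pos_of_lt_pi (by linarith [hx.1]) (by linarith [hx.2, Real.pi_pos]),
   Real.cos_pos_of_mem_Ioo ⟨by linarith [hx.1, Real.pi_pos], by linarith [hx.2]⟩⟩

lemma trig_beta {p q : ℝ} (hp : 1/2 ≤ p) (hq : 1/2 ≤ q) :
    ∫ x in (0:ℝ)..Real.pi, Real.sin (x/2) ^ (2*p-1) * Real.cos (x/2) ^ (2*q-1)
      = Real.Gamma p * Real.Gamma q / Real.Gamma (p+q) := by
  obtain ⟨hi, hv⟩ := real_beta (p := p) (q := q) (by linarith) (by linarith)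
  have hpi := Real.pi_pos
  have key : Set.EqOn (fun x : ℝ => ((fun u : ℝ => u ^ (p-1) * (1-u) ^ (q-1)) ∘
      (fun x : ℝ => Real.sin (x/2) ^ 2)) x * (Real.sin (x/2) * Real.cos (x/2)))
      (fun x => Real.sin (x/2) ^ (2*p-1) * Real.cos (x/2) ^ (2*q-1)) (Set.Ioo 0 Real.pi) := by
    intro x hx
    obtain ⟨h1, h2⟩ := half_pos' hx
    have e : 1 - Real.sin (x/2) ^ 2 = Real.cos (x/2) ^ 2 := by
      rw [← Real.sin_sq_add_cos_sq (x/2)]; ring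
    have aux : ∀ y r : ℝ, 0 < y → y ^ (2*r-1) = (y^2) ^ (r-1) * y := by
      intro y r hy
      rw [← Real.rpow_natCast y 2, ← Real.rpow_mul hy.le, ← Real.rpow_add_one hy.ne']
      congr 1; push_cast; ring
    simp only [Function.comp, e, aux _ _ h1, aux _ _ h2]
    ring
  rw [← intervalIntegral.integral_congr_Ioo_of_le hpi.le key,
    intervalIntegral.integral_comp_mul_deriv''' (f := fun x : ℝ => Real.sin (x/2) ^ 2)]
  · simpa using hv
  · fun_prop
  · intro x hx
    have := ((Real.hasDerivAt_sin (x/2)).comp x ((hasDerivAt_id x).div_const 2)).pow 2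
    refine (this.congr_deriv ?_).hasDerivWithinAt
    simp; ring
  · rintro _ ⟨x, hx, rfl⟩
    rw [min_eq_left hpi.le, max_eq_right hpi.le] at hx
    obtain ⟨h1, h2⟩ := half_pos' hx
    have e : 1 - Real.sin (x/2) ^ 2 = Real.cos (x/2) ^ 2 := by
      rw [← Real.sin_sq_add_cos_sq (x/2)]; ring
    refine ContinuousAt.continuousWithinAt ?_
    refine (continuousAt_id.rpow_const (Or.inl ?_)).mul
      ((continuousAt_const.sub continuousAt_id).rpow_const (Or.inl ?_))
    · simp; exact h1.ne'
    · change 1 - Real.sin (x/2) ^ 2 ≠ 0; rw [e]; positivity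
  · have : (fun x : ℝ => Real.sin (x/2) ^ 2) '' Set.uIcc 0 Real.pi ⊆ Set.Icc 0 1 := by
      rintro _ ⟨x, hx, rfl⟩
      exact ⟨by positivity, Real.sin_sq_le_one _⟩
    refine MeasureTheory.IntegrableOn.mono_set ?_ this
    rw [integrableOn_Icc_iff_integrableOn_Ioc]
    exact (intervalIntegrable_iff_integrableOn_Ioc_of_le zero_le_one).1 hi
  · rw [Set.uIcc_of_le hpi.le, integrableOn_Icc_iff_integrableOn_Ioo]
    refine MeasureTheory.IntegrableOn.congr_fun ?_ key.symm measurableSet_Ioo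
    rw [← integrableOn_Icc_iff_integrableOn_Ioo]
    exact (trig_cont (by linarith) (by linarith)).continuousOn.integrableOn_Icc

lemma coeff_formula (α β H : ℝ) (hβ : -1/2 ≤ β) (hαβ : β ≤ α) (hH : 0 ≤ H) (n : ℕ) :
    ∫ x in (0:ℝ)..Real.pi, Real.sin (x/2) ^ (2*H) * jacobiP α β (n+1) (Real.cos x) *
      Real.sin (x / 2) ^ (2 * α + 1) * Real.cos (x / 2) ^ (2 * β + 1)
    = pch (-H) (n+1) / (n+1).factorial * Real.Gamma (α+H+1) * Real.Gamma (β+1+(n+1:ℕ)) /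
        Real.Gamma (α+β+1+H+1+(n+1:ℕ)) := by
  have hα1 : 0 < α + 1 := by linarith
  have hβ1 : 0 < β + 1 := by linarith
  have hs1 : 0 < α + β + 1 + 1 := by linarith
  have hsH : 0 < α + β + 1 + H + 1 := by linarith
  have haH : 0 < α + H + 1 := by linarith
  have hsn : 0 < α + β + 1 + (n+1:ℕ) := by
    push_cast; linarith [(Nat.cast_nonneg n : (0:ℝ) ≤ n)]
  set N := n + 1 with hN
  have e1 : Set.EqOn (fun x => Real.sin (x/2) ^ (2*H) * jacobiP α β N (Real.cos x) *
      Real.sin (x / 2) ^ (2 * α + 1) * Real.cos (x / 2) ^ (2 * β + 1))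
      (fun x => ∑ k ∈ range (N+1), (Real.Gamma (α + N + 1) / (N.factorial * Real.Gamma (α + β + N + 1))
        * ((N.choose k : ℝ) * (Real.Gamma (α + β + N + k + 1) / Real.Gamma (α + k + 1)) * (-1)^k)) *
        (Real.sin (x/2) ^ (2*(α+H+1+k)-1) * Real.cos (x/2) ^ (2*(β+1)-1))) (Set.Ioo 0 Real.pi) := by
    intro x hx
    obtain ⟨h1, h2⟩ := half_pos' hx
    have e : (Real.cos x - 1)/2 = (-1) * Real.sin (x/2) ^ 2 := by
      have := Real.cos_sq_add_sin_sq (x/2)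
      have h : Real.cos x = 2 * Real.cos (x/2) ^ 2 - 1 := by rw [← Real.cos_two_mul]; ring_nf
      rw [h]; linarith
    simp only [jacobiP, e, mul_sum, sum_mul]
    refine sum_congr rfl fun k _ => ?_
    have : Real.sin (x/2) ^ (2*(α+H+1+k)-1)
       = Real.sin (x/2) ^ (2*H) * Real.sin (x/2) ^ (2*α+1) * (Real.sin (x/2)^2)^k := by
      rw [← pow_mul, ← Real.rpow_natCast, ← Real.rpow_add h1, ← Real.rpow_add h1]
      congr 1; push_cast; ring
    rw [this, show 2*(β+1)-1 = 2*β+1 by ring, mul_pow]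
    ring
  rw [intervalIntegral.integral_congr_Ioo_of_le Real.pi_pos.le e1,
    intervalIntegral.integral_finsetSum]
  swap
  · intro k _
    refine (Continuous.intervalIntegrable ?_ _ _)
    have hk : (0:ℝ) ≤ k := Nat.cast_nonneg k
    exact continuous_const.mul (trig_cont (by linarith) (by linarith))
  have e2 : ∀ k ∈ range (N+1), ∫ x in (0:ℝ)..Real.pi,
      (Real.Gamma (α + N + 1) / (N.factorial * Real.Gamma (α + β + N + 1))
        * ((N.choose k : ℝ) * (Real.Gamma (α + β + N + k + 1) / Real.Gamma (α + k + 1)) * (-1)^k)) *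
        (Real.sin (x/2) ^ (2*(α+H+1+k)-1) * Real.cos (x/2) ^ (2*(β+1)-1))
      = (pch (α+1) N * Real.Gamma (α+H+1) * Real.Gamma (β+1) / (N.factorial * Real.Gamma (α+β+1+H+1)))
          * tt α (α+β+1) H N k := by
    intro k _
    have hk : (0:ℝ) ≤ k := Nat.cast_nonneg k
    rw [intervalIntegral.integral_const_mul, trig_beta (by linarith) (by linarith),
      show α + N + 1 = α + 1 + N by ring, show α + β + N + 1 = α + β + 1 + N by ring,
      show α + β + N + k + 1 = α + β + 1 + N + k by ring, show α + k + 1 = α + 1 + k by ring,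
      show α + H + 1 + k + (β + 1) = α + β + 1 + H + 1 + k by ring,
      Gamma_pch hα1, Gamma_pch hα1, Gamma_pch hsn, Gamma_pch haH, Gamma_pch hsH, tt]
    have g1 := (Real.Gamma_pos_of_pos hα1).ne'
    have g2 := (Real.Gamma_pos_of_pos hsn).ne'
    have g3 := (Real.Gamma_pos_of_pos hsH).ne'
    have p1 := (pch_pos hα1 k).ne'
    have p2 := (pch_pos hsH k).ne'
    have f : (N.factorial:ℝ) ≠ 0 := by exact_mod_cast N.factorial_ne_zero
    field_simp
  rw [sum_congr rfl e2, ← mul_sum, hN, saal_s10 α (α+β+1) H hα1 hsH hs1 n, ← hN,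
    show α+β+1-α = β+1 by ring, Gamma_pch hβ1, Gamma_pch hsH]
  have g3 := (Real.Gamma_pos_of_pos hsH).ne'
  have p1 := (pch_pos hα1 N).ne'
  have p2 := (pch_pos hsH N).ne'
  have f : (N.factorial:ℝ) ≠ 0 := by exact_mod_cast N.factorial_ne_zero
  field_simp

lemma jacobi_cont (α β : ℝ) (n : ℕ) : Continuous (jacobiP α β n) := by
  unfold jacobiP; fun_prop

/-- Example 1: with H = ν/2, the Jacobi coefficients of
`1 − sin^ν(x/2)` satisfy `n^{ν+1} b_n → −2Γ(α+H+1)/(Γ(α+1)Γ(−H))`, a positive limit. -/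
theorem stmt10 (α β : ℝ) (hβ : -1/2 ≤ β) (hαβ : β ≤ α) (ν : ℝ) (hν : ν ∈ Set.Ioo (0:ℝ) 2) :
    (0 < -2 * Real.Gamma (α + ν/2 + 1) / (Real.Gamma (α+1) * Real.Gamma (-(ν/2)))) ∧
    Filter.Tendsto
      (fun n : ℕ => (n:ℝ) ^ (ν + 1) *
        jacobiCoeff α β n (fun x => 1 - Real.sin (x/2) ^ ν))
      Filter.atTop
      (nhds (-2 * Real.Gamma (α + ν/2 + 1) / (Real.Gamma (α+1) * Real.Gamma (-(ν/2))))) := by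
  obtain ⟨hν0, hν2⟩ := hν
  obtain ⟨H, rfl⟩ : ∃ H, ν = 2 * H := ⟨ν/2, by ring⟩
  rw [show 2 * H / 2 = H by ring]
  have hH0 : 0 < H := by linarith
  have hH1 : H < 1 := by linarith
  have hα1 : 0 < α + 1 := by linarith
  have hβ1 : 0 < β + 1 := by linarith
  have hs1 : 0 < α + β + 1 + 1 := by linarith
  have hsH : 0 < α + β + 1 + H + 1 := by linarith
  have haH : 0 < α + H + 1 := by linarith
  have G1 := Real.Gamma_pos_of_pos hα1
  have G2 := Real.Gamma_pos_of_pos haH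
  have G3 := Real.Gamma_pos_of_pos hs1
  have G4 := Real.Gamma_pos_of_pos hsH
  have GH : Real.Gamma (-H) < 0 := by
    have h1 := Real.Gamma_add_one (s := -H) (by linarith)
    have h2 := Real.Gamma_pos_of_pos (s := -H + 1) (by linarith)
    by_contra! h
    nlinarith
  refine ⟨div_pos_of_neg_of_neg (by nlinarith) (mul_neg_of_pos_of_neg G1 GH), ?_⟩
  have L1 := pch_lim (α+β+1+1) (fun m h => by
    linarith [(Nat.cast_nonneg m : (0:ℝ) ≤ m)])
  have L2 := (pch_lim (α+β+1+H+1) (fun m h => by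
    linarith [(Nat.cast_nonneg m : (0:ℝ) ≤ m)])).inv₀ (inv_ne_zero G4.ne')
  have L3 := pch_lim (-H) (fun m h => by
    have h' : H = m := by linarith
    rw [h'] at hH0 hH1
    norm_cast at hH0 hH1
    omega)
  have L4 : Tendsto (fun n : ℕ => 1 + (n:ℝ)/(n + (α+β+1))) atTop (𝓝 (1 + 1)) :=
    tendsto_const_nhds.add (tendsto_natCast_div_add_atTop _)
  have L5 := ((((L1.mul L2).mul L3).mul L4).const_mul
    (-(Real.Gamma (α+H+1) / Real.Gamma (α+1) * Real.Gamma (α+β+1+1) / Real.Gamma (α+β+1+H+1))))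
  refine (L5.congr' ?_).trans (le_of_eq ?_)
  swap
  · congr 1
    have := GH.ne
    field_simp
    ring
  filter_upwards [eventually_gt_atTop 0] with N hN
  obtain ⟨n, rfl⟩ : ∃ n, N = n + 1 := ⟨N - 1, by omega⟩
  have I1 := coeff_formula α β H hβ hαβ hH0.le n
  have I0 := coeff_formula α β 0 hβ hαβ le_rfl n
  have z : pch (-0) (n+1) = 0 := by
    rw [pch, prod_range_succ']; simp
  rw [z] at I0
  simp only [mul_zero, Real.rpow_zero, one_mul, zero_div, zero_mul] at I0
  have cj : Continuous fun x => jacobiP α β (n+1) (Real.cos x) :=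
    (jacobi_cont α β (n+1)).comp Real.continuous_cos
  have hsin : Continuous fun x : ℝ => Real.sin (x/2) := by fun_prop
  have hcos : Continuous fun x : ℝ => Real.cos (x/2) := by fun_prop
  have c1 : Continuous fun x : ℝ => Real.sin (x/2) ^ (2*α+1) :=
    hsin.rpow_const fun x => Or.inr (by linarith)
  have c2 : Continuous fun x : ℝ => Real.cos (x/2) ^ (2*β+1) :=
    hcos.rpow_const fun x => Or.inr (by linarith)
  have c3 : Continuous fun x : ℝ => Real.sin (x/2) ^ (2*H) :=
    hsin.rpow_const fun x => Or.inr (by linarith)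
  have I : ∫ x in (0:ℝ)..Real.pi, (1 - Real.sin (x/2) ^ (2*H)) * jacobiP α β (n+1) (Real.cos x) *
      Real.sin (x / 2) ^ (2 * α + 1) * Real.cos (x / 2) ^ (2 * β + 1)
      = - (pch (-H) (n+1) / (n+1).factorial * Real.Gamma (α+H+1) * Real.Gamma (β+1+(n+1:ℕ)) /
        Real.Gamma (α+β+1+H+1+(n+1:ℕ))) := by
    rw [← I1, ← zero_sub]
    refine Eq.trans ?_ (congrArg (· - _) I0)
    beta_reduce
    rw [← intervalIntegral.integral_sub]
    · congr 1; ext x; ring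
    · exact ((cj.mul c1).mul c2).intervalIntegrable _ _
    · exact (((c3.mul cj).mul c1).mul c2).intervalIntegrable _ _
  simp only [jacobiCoeff]
  rw [I]
  set N := n + 1 with hN'
  have hNp : (0:ℝ) < N := by exact_mod_cast hN
  have hN1 : (1:ℝ) ≤ N := by exact_mod_cast hN
  have hsn : 0 < (N:ℝ) + (α + β + 1) := by linarith
  have hg : Real.Gamma (N + α + β + 1) =
      pch (α+β+1+1) N * Real.Gamma (α+β+1+1) / (N + (α+β+1)) := by
    rw [← Gamma_pch hs1, show α+β+1+1+N = (N+α+β+1) + 1 by ring,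
      Real.Gamma_add_one (s := N+α+β+1) (by linarith), eq_div_iff hsn.ne']
    ring
  have hb : Real.Gamma (N + β + 1) ≠ 0 := (Real.Gamma_pos_of_pos (by linarith)).ne'
  rw [hg, show β + 1 + (N:ℝ) = N + β + 1 by ring, Gamma_pch hsH]
  have p2 := (pch_pos hsH N).ne'
  have f : (N.factorial:ℝ) ≠ 0 := by exact_mod_cast N.factorial_ne_zero
  have q : (N:ℝ) ^ (2*H+1) = (N:ℝ)^(1-(α+β+1+1)) * (N:ℝ)^(1-(-H)) / (N:ℝ)^(1-(α+β+1+H+1)) := by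
    rw [← Real.rpow_add hNp, ← Real.rpow_sub hNp]
    congr 1; ring
  rw [q]
  have r := (Real.rpow_pos_of_pos hNp (1-(α+β+1+H+1))).ne'
  generalize (N:ℝ)^(1-(α+β+1+H+1)) = R at *
  generalize (N:ℝ)^(1-(α+β+1+1)) = R1 at *
  generalize (N:ℝ)^(1-(-H)) = R2 at *
  field_simp
  ring
end

section
/- Let α ≥ −1/2 be a real number, β = −1/2, and p_0(x) = (π − x)². Then the Jacobi coefficients of p_0 satisfy lim_{n→∞} n² · b_n^{(α,−1/2)}(p_0) = 4√π Γ(α+3/2) / Γ(α+1). -/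
open Polynomial in
lemma diff_inv (N : ℕ) : ∀ y : ℝ, 0 < y →
    (fwdDiff (1:ℝ))^[N] (fun z : ℝ => 1 / z) y
      = (-1) ^ N * N.factorial / (ascPochhammer ℝ (N + 1)).eval y := by
  induction N with
  | zero => intro y hy; simp
  | succ N ih =>
    intro y hy
    rw [Function.iterate_succ_apply', fwdDiff, ih y hy, ih (y + 1) (by linarith)]
    have h1 : (ascPochhammer ℝ (N + 1 + 1)).eval y
        = y * (ascPochhammer ℝ (N + 1)).eval (y + 1) := by
      rw [ascPochhammer_succ_left]; simp
    have h2 : (ascPochhammer ℝ (N + 1 + 1)).eval y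
        = (ascPochhammer ℝ (N + 1)).eval y * (y + (N + 1 : ℕ)) := by
      rw [ascPochhammer_succ_right]; simp
    have p1 := ascPochhammer_pos (N + 1) y hy
    have p2 := ascPochhammer_pos (N + 1) (y + 1) (by linarith)
    have p3 : 0 < y + (N + 1 : ℕ) := by positivity
    have e1 : (ascPochhammer ℝ (N + 1)).eval (y + 1)
        = (ascPochhammer ℝ (N + 1)).eval y * (y + (N + 1 : ℕ)) / y := by
      field_simp; linarith
    rw [h2, e1, Nat.factorial_succ]
    field_simp
    push_cast
    ring

open Polynomial in
lemma diff_main (N : ℕ) (s : ℝ) (hs : 0 < s) :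
    ∑ k ∈ Finset.range (N + 1), (-1 : ℝ) ^ k * (N.choose k) *
      ((ascPochhammer ℝ N).eval (s + k + 1) / (s + k))
      = (N.factorial : ℝ) ^ 2 / (ascPochhammer ℝ (N + 1)).eval s := by
  rcases Nat.eq_zero_or_pos N with rfl | hN
  · simp
  set Q : ℝ[X] := (ascPochhammer ℝ N).comp (X + 1) with hQ
  have hQd : Q.natDegree = N := by
    rw [hQ, natDegree_comp, ascPochhammer_natDegree]
    have : (X + 1 : ℝ[X]).natDegree = 1 := by
      have := natDegree_X_add_C (1:ℝ); simpa using this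
    rw [this, mul_one]
  have hQ0 : Q.coeff 0 = N.factorial := by
    rw [coeff_zero_eq_eval_zero, hQ]; simp
  have hd : Q.divX.natDegree < N := by
    rw [natDegree_divX_eq_natDegree_tsub_one, hQd]; omega
  have hz := fwdDiff_iter_eq_zero_of_degree_lt hd
  have hz' := congrFun hz s
  have hi := diff_inv N s hs
  rw [fwdDiff_iter_eq_sum_shift] at hz' hi
  have hev : ∀ y : ℝ, 0 < y → (ascPochhammer ℝ N).eval (y + 1) / y
      = Q.divX.eval y + N.factorial * (1 / y) := by
    intro y hy
    have : Q.eval y = (Q.divX * X + C (Q.coeff 0)).eval y := by rw [divX_mul_X_add]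
    rw [hQ0] at this
    simp only [eval_add, eval_mul, eval_X, eval_C] at this
    have h3 : Q.eval y = (ascPochhammer ℝ N).eval (y + 1) := by simp [hQ]
    rw [← h3, this]; field_simp
  have hsum : ∑ k ∈ Finset.range (N + 1), (-1 : ℝ) ^ k * (N.choose k) *
      ((ascPochhammer ℝ N).eval (s + k + 1) / (s + k))
      = (-1) ^ N * (∑ k ∈ Finset.range (N + 1), ((-1 : ℤ) ^ (N - k) * (N.choose k)) • Q.divX.eval (s + k • (1:ℝ)))
      + (-1) ^ N * N.factorial * (∑ k ∈ Finset.range (N + 1), ((-1 : ℤ) ^ (N - k) * (N.choose k)) • (1 / (s + k • (1:ℝ)))) := by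
    rw [Finset.mul_sum, Finset.mul_sum, ← Finset.sum_add_distrib]
    apply Finset.sum_congr rfl
    intro k hk
    have hk' : k ≤ N := by simpa [Nat.lt_succ_iff] using hk
    rw [hev (s + k) (by positivity)]
    have hsg : (-1 : ℝ) ^ N * (-1) ^ (N - k) = (-1) ^ k := by
      obtain ⟨j, rfl⟩ := Nat.exists_eq_add_of_le hk'
      rw [Nat.add_sub_cancel_left, pow_add, mul_assoc, ← mul_pow]; simp
    rw [← hsg]
    simp only [zsmul_eq_mul, nsmul_eq_mul, mul_one]
    push_cast
    ring
  rw [hsum, hi, hz']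
  have : (-1 : ℝ) ^ N * (-1) ^ N = 1 := by rw [← mul_pow]; simp
  simp only [Pi.zero_apply, mul_zero, zero_add]
  linear_combination ((N.factorial : ℝ) ^ 2 / (ascPochhammer ℝ (N + 1)).eval s) * this

open Polynomial in
lemma by_parts (N : ℕ) (s : ℝ) (U : ℕ → ℝ) (K : ℕ) :
    (s + N) * ∑ k ∈ Finset.range (K + 1), (-1 : ℝ) ^ k * ((N + 1).choose k) *
      (ascPochhammer ℝ N).eval (s + k) * U k
    = ∑ k ∈ Finset.range K, (-1 : ℝ) ^ k * (N.choose k) *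
      (ascPochhammer ℝ (N + 1)).eval (s + k) * (U k - U (k + 1))
      + (-1 : ℝ) ^ K * (N.choose K) * (ascPochhammer ℝ (N + 1)).eval (s + K) * U K := by
  induction K with
  | zero =>
    have : (ascPochhammer ℝ (N + 1)).eval s = (ascPochhammer ℝ N).eval s * (s + N) := by
      rw [ascPochhammer_succ_right]; simp
    simp [this]; ring
  | succ K ih =>
    rw [Finset.sum_range_succ, mul_add, ih, Finset.sum_range_succ]
    have h1 : (ascPochhammer ℝ (N + 1)).eval (s + K)
        = (s + K) * (ascPochhammer ℝ N).eval (s + (K + 1 : ℕ)) := by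
      rw [ascPochhammer_succ_left]; simp [add_assoc]
    have h2 : (ascPochhammer ℝ (N + 1)).eval (s + (K + 1 : ℕ))
        = (ascPochhammer ℝ N).eval (s + (K + 1 : ℕ)) * (s + (K + 1 : ℕ) + N) := by
      rw [ascPochhammer_succ_right]; simp
    have h3 : ((N.choose (K + 1) : ℕ) : ℝ) * (K + 1) = N.choose K * (N - K) := by
      rcases le_or_gt K N with h | h
      · have := Nat.choose_succ_right_eq N K
        have h' := congrArg (Nat.cast : ℕ → ℝ) this
        push_cast [Nat.cast_sub h] at h'
        exact h'
      · rw [Nat.choose_eq_zero_of_lt h, Nat.choose_eq_zero_of_lt (by omega)]; simp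
    rw [h1, h2, Nat.choose_succ_succ]
    generalize (ascPochhammer ℝ N).eval (s + (K + 1 : ℕ)) = E
    simp only [Nat.succ_eq_add_one]
    push_cast
    rw [pow_succ]
    linear_combination ((-1:ℝ)^K * E * U (K+1)) * h3

open Polynomial in
lemma comb (N : ℕ) (s : ℝ) (hs : 0 < s) (U : ℕ → ℝ)
    (hU : ∀ k : ℕ, U k - U (k + 1) = 2 / (s + k) ^ 2) :
    (s + N) * ∑ k ∈ Finset.range (N + 1 + 1), (-1 : ℝ) ^ k * ((N + 1).choose k) *
      (ascPochhammer ℝ N).eval (s + k) * U k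
    = 2 * ((N.factorial : ℝ) ^ 2 / (ascPochhammer ℝ (N + 1)).eval s) := by
  rw [by_parts, ← diff_main N s hs, Finset.mul_sum]
  simp only [Nat.choose_succ_self, Nat.cast_zero, mul_zero, zero_mul, add_zero]
  apply Finset.sum_congr rfl
  intro k hk
  have h1 : (ascPochhammer ℝ (N + 1)).eval (s + k)
      = (s + k) * (ascPochhammer ℝ N).eval (s + k + 1) := by
    rw [ascPochhammer_succ_left]; simp [add_assoc]
  have : 0 < s + k := by positivity
  rw [h1, hU]
  field_simp

lemma gamma_add (y : ℝ) (hy : 0 < y) (n : ℕ) :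
    Real.Gamma (y + n) = (ascPochhammer ℝ n).eval y * Real.Gamma y := by
  induction n with
  | zero => simp
  | succ n ih =>
    have : y + (n + 1 : ℕ) = (y + n) + 1 := by push_cast; ring
    rw [this, Real.Gamma_add_one (by positivity), ih, ascPochhammer_succ_right]
    simp; ring

lemma gamma_lim (y : ℝ) (hy : 0 < y) :
    Filter.Tendsto (fun n : ℕ => (n:ℝ) ^ y * n.factorial / Real.Gamma (y + n + 1))
      Filter.atTop (nhds 1) := by
  have h := (Real.GammaSeq_tendsto_Gamma y).div_const (Real.Gamma y)
  have hg := Real.Gamma_pos_of_pos hy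
  rw [div_self hg.ne'] at h
  refine h.congr (fun n => ?_)
  have h1 : y + n + 1 = y + (n + 1 : ℕ) := by push_cast; ring
  have h2 : ∀ m : ℕ, ∏ j ∈ Finset.range m, (y + (j:ℝ)) = (ascPochhammer ℝ m).eval y := by
    intro m
    induction m with
    | zero => simp
    | succ m ih => rw [Finset.prod_range_succ, ih, ascPochhammer_succ_right]; simp
  rw [h1, gamma_add y hy, Real.GammaSeq, div_div, h2]


lemma sinN_rec (a : ℝ) (ha : 0 ≤ a) :
    (a + 2) * ∫ x in (0:ℝ)..Real.pi, Real.sin (x / 2) ^ (a + 2)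
      = (a + 1) * ∫ x in (0:ℝ)..Real.pi, Real.sin (x / 2) ^ a := by
  have hc : ∀ b : ℝ, 0 ≤ b → Continuous (fun x : ℝ => Real.sin (x / 2) ^ b) := fun b hb =>
    (Real.continuous_sin.comp (by fun_prop)).rpow_const (fun x => Or.inr hb)
  have key := intervalIntegral.integral_eq_sub_of_hasDerivAt (a := 0) (b := Real.pi)
    (f := fun x => 2 * (Real.sin (x / 2) ^ (a + 1) * Real.cos (x / 2)))
    (f' := fun x => (a + 1) * Real.sin (x / 2) ^ a - (a + 2) * Real.sin (x / 2) ^ (a + 2)) ?_ ?_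
  · rw [intervalIntegral.integral_sub, intervalIntegral.integral_const_mul,
      intervalIntegral.integral_const_mul] at key
    · simp [Real.zero_rpow (show a + 1 ≠ 0 by linarith)] at key
      linarith
    · exact ((hc a ha).const_smul (a + 1)).intervalIntegrable _ _
    · exact ((hc (a + 2) (by linarith)).const_smul (a + 2)).intervalIntegrable _ _
  · intro x hx
    have hs0 : 0 ≤ Real.sin (x / 2) := by
      rw [Set.uIcc_of_le Real.pi_pos.le] at hx
      exact Real.sin_nonneg_of_nonneg_of_le_pi (by linarith [hx.1]) (by linarith [hx.2, Real.pi_pos])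
    have hh : HasDerivAt (fun x : ℝ => x / 2) (1 / 2) x := (hasDerivAt_id x).div_const 2
    have hsn := hh.sin
    have hcs := hh.cos
    have h1 := hsn.rpow_const (p := a + 1) (Or.inr (by linarith))
    convert! (h1.mul hcs).const_mul 2 using 1
    have e1 : a + 1 - 1 = a := by ring
    have e2 : Real.sin (x / 2) ^ (a + 1) = Real.sin (x / 2) ^ a * Real.sin (x / 2) := by
      rw [Real.rpow_add_of_nonneg hs0 ha zero_le_one, Real.rpow_one]
    have e3 : Real.sin (x / 2) ^ (a + 2) = Real.sin (x / 2) ^ a * Real.sin (x / 2) ^ 2 := by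
      rw [Real.rpow_add_of_nonneg hs0 ha zero_le_two, Real.rpow_two]
    rw [e1, e2, e3]
    have := Real.sin_sq_add_cos_sq (x / 2)
    linear_combination (-(a + 1) * Real.sin (x / 2) ^ a) * this
  · exact (((hc a ha).const_smul (a + 1)).sub
      ((hc (a + 2) (by linarith)).const_smul (a + 2))).intervalIntegrable _ _

lemma sinM_rec (a : ℝ) (ha : 0 ≤ a) :
    (a + 2) * ∫ x in (0:ℝ)..Real.pi, (Real.pi - x) ^ 2 * Real.sin (x / 2) ^ (a + 2)
      = (a + 1) * (∫ x in (0:ℝ)..Real.pi, (Real.pi - x) ^ 2 * Real.sin (x / 2) ^ a)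
        - 8 / (a + 2) * ∫ x in (0:ℝ)..Real.pi, Real.sin (x / 2) ^ (a + 2) := by
  have hc : ∀ b : ℝ, 0 ≤ b → Continuous (fun x : ℝ => Real.sin (x / 2) ^ b) := fun b hb =>
    (Real.continuous_sin.comp (by fun_prop)).rpow_const (fun x => Or.inr hb)
  have hc2 : ∀ b : ℝ, 0 ≤ b → Continuous (fun x : ℝ => (Real.pi - x) ^ 2 * Real.sin (x / 2) ^ b) :=
    fun b hb => Continuous.mul (by fun_prop) (hc b hb)
  have ha2 : (a + 2) ≠ 0 := by linarith
  have key := intervalIntegral.integral_eq_sub_of_hasDerivAt (a := 0) (b := Real.pi)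
    (f := fun x => (Real.pi - x) ^ 2 * (2 * (Real.sin (x / 2) ^ (a + 1) * Real.cos (x / 2)))
      + (8 / (a + 2)) * ((Real.pi - x) * Real.sin (x / 2) ^ (a + 2)))
    (f' := fun x => (a + 1) * ((Real.pi - x) ^ 2 * Real.sin (x / 2) ^ a)
      - (a + 2) * ((Real.pi - x) ^ 2 * Real.sin (x / 2) ^ (a + 2))
      - (8 / (a + 2)) * Real.sin (x / 2) ^ (a + 2)) ?_ ?_
  · have i1 : IntervalIntegrable (fun x : ℝ => (a + 1) * ((Real.pi - x) ^ 2 * Real.sin (x / 2) ^ a)) MeasureTheory.volume 0 Real.pi := ((hc2 a ha).const_smul (a + 1)).intervalIntegrable _ _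
    have i2 : IntervalIntegrable (fun x : ℝ => (a + 2) * ((Real.pi - x) ^ 2 * Real.sin (x / 2) ^ (a + 2))) MeasureTheory.volume 0 Real.pi := ((hc2 (a + 2) (by linarith)).const_smul (a + 2)).intervalIntegrable _ _
    have i3 : IntervalIntegrable (fun x : ℝ => (8 / (a + 2)) * Real.sin (x / 2) ^ (a + 2)) MeasureTheory.volume 0 Real.pi := ((hc (a + 2) (by linarith)).const_smul (8 / (a + 2))).intervalIntegrable _ _
    rw [intervalIntegral.integral_sub (i1.sub i2) i3, intervalIntegral.integral_sub i1 i2,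
      intervalIntegral.integral_const_mul,
      intervalIntegral.integral_const_mul, intervalIntegral.integral_const_mul] at key
    simp only [sub_self, zero_div, Real.sin_zero, Real.zero_rpow (show a + 1 ≠ 0 by linarith),
      Real.zero_rpow ha2] at key
    linarith
  · intro x hx
    have hs0 : 0 ≤ Real.sin (x / 2) := by
      rw [Set.uIcc_of_le Real.pi_pos.le] at hx
      exact Real.sin_nonneg_of_nonneg_of_le_pi (by linarith [hx.1]) (by linarith [hx.2, Real.pi_pos])
    have hh : HasDerivAt (fun x : ℝ => x / 2) (1 / 2) x := (hasDerivAt_id x).div_const 2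
    have hp : HasDerivAt (fun x : ℝ => Real.pi - x) (-1) x := (hasDerivAt_id x).const_sub _
    have hsn := hh.sin
    have hcs := hh.cos
    have h1 := hsn.rpow_const (p := a + 1) (Or.inr (by linarith))
    have h2 := hsn.rpow_const (p := a + 2) (Or.inr (by linarith))
    convert! ((hp.pow 2).mul ((h1.mul hcs).const_mul 2)).add
      ((hp.mul h2).const_mul (8 / (a + 2))) using 1
    have e1 : a + 1 - 1 = a := by ring
    have e1' : a + 2 - 1 = a + 1 := by ring
    have e2 : Real.sin (x / 2) ^ (a + 1) = Real.sin (x / 2) ^ a * Real.sin (x / 2) := by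
      rw [Real.rpow_add_of_nonneg hs0 ha zero_le_one, Real.rpow_one]
    have e3 : Real.sin (x / 2) ^ (a + 2) = Real.sin (x / 2) ^ a * Real.sin (x / 2) ^ 2 := by
      rw [Real.rpow_add_of_nonneg hs0 ha zero_le_two, Real.rpow_two]
    simp only [Pi.mul_apply, Pi.pow_apply]
    rw [e1, e1', e2, e3]
    have := Real.sin_sq_add_cos_sq (x / 2)
    field_simp
    push_cast
    linear_combination (-2 * (a + 1) * (a + 2) * (Real.pi - x) ^ 2 * Real.sin (x / 2) ^ a) * this
  · exact ((((hc2 a ha).const_smul (a + 1)).sub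
      ((hc2 (a + 2) (by linarith)).const_smul (a + 2))).sub
      ((hc (a + 2) (by linarith)).const_smul (8 / (a + 2)))).intervalIntegrable _ _

lemma beta_real (u v : ℝ) (hu : 0 < u) (hv : 0 < v) :
    ∫ x in Set.Ioo (0:ℝ) 1, x ^ (u - 1) * (1 - x) ^ (v - 1)
      = Real.Gamma u * Real.Gamma v / Real.Gamma (u + v) := by
  have h := ProbabilityTheory.beta_eq_betaIntegralReal u v hu hv
  rw [ProbabilityTheory.beta] at h
  rw [h, Complex.betaIntegral, intervalIntegral.integral_of_le zero_le_one,
    MeasureTheory.integral_Ioc_eq_integral_Ioo]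
  have : ∫ x in Set.Ioo (0:ℝ) 1, (x:ℂ) ^ ((u:ℂ) - 1) * (1 - (x:ℂ)) ^ ((v:ℂ) - 1)
      = ∫ x in Set.Ioo (0:ℝ) 1, ((x ^ (u - 1) * (1 - x) ^ (v - 1) : ℝ) : ℂ) := by
    apply MeasureTheory.setIntegral_congr_fun measurableSet_Ioo
    intro x hx
    simp only
    rw [Complex.ofReal_mul, Complex.ofReal_cpow hx.1.le, Complex.ofReal_cpow (by linarith [hx.2])]
    push_cast
    rfl
  rw [this, integral_complex_ofReal, Complex.ofReal_re]

lemma sinN_val (a : ℝ) (ha : 0 ≤ a) :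
    ∫ x in (0:ℝ)..Real.pi, Real.sin (x / 2) ^ a
      = Real.sqrt Real.pi * Real.Gamma ((a + 1) / 2) / Real.Gamma (a / 2 + 1) := by
  have hb := beta_real ((a + 1) / 2) (1 / 2) (by linarith) (by norm_num)
  rw [Real.Gamma_one_half_eq, show (a + 1) / 2 + 1 / 2 = a / 2 + 1 by ring] at hb
  rw [mul_comm (Real.sqrt Real.pi), ← hb, intervalIntegral.integral_of_le Real.pi_pos.le,
    MeasureTheory.integral_Ioc_eq_integral_Ioo]
  have him : (fun x : ℝ => (1 - Real.cos x) / 2) '' Set.Ioo 0 Real.pi = Set.Ioo 0 1 := by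
    ext t
    constructor
    · rintro ⟨x, hx, rfl⟩
      have h1 : Real.cos x < Real.cos 0 :=
        Real.strictAntiOn_cos ⟨le_rfl, Real.pi_pos.le⟩ ⟨hx.1.le, hx.2.le⟩ hx.1
      have h2 : Real.cos Real.pi < Real.cos x :=
        Real.strictAntiOn_cos ⟨hx.1.le, hx.2.le⟩ ⟨Real.pi_pos.le, le_rfl⟩ hx.2
      rw [Real.cos_zero] at h1
      rw [Real.cos_pi] at h2
      constructor <;> simp only <;> linarith
    · intro ht
      refine ⟨Real.arccos (1 - 2 * t), ⟨?_, ?_⟩, ?_⟩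
      · rw [Real.arccos_pos]; linarith [ht.1]
      · refine lt_of_le_of_ne (Real.arccos_le_pi _) ?_
        rw [Ne, Real.arccos_eq_pi]; linarith [ht.2]
      · simp only
        rw [Real.cos_arccos (by linarith [ht.2]) (by linarith [ht.1])]; ring
  have hinj : Set.InjOn (fun x : ℝ => (1 - Real.cos x) / 2) (Set.Ioo 0 Real.pi) := by
    intro x hx y hy h
    simp only at h
    exact Real.injOn_cos ⟨hx.1.le, hx.2.le⟩ ⟨hy.1.le, hy.2.le⟩ (by linarith)
  have hsub := MeasureTheory.integral_image_eq_integral_abs_deriv_smul (s := Set.Ioo 0 Real.pi)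
    (f := fun x : ℝ => (1 - Real.cos x) / 2) (f' := fun x => Real.sin x / 2) measurableSet_Ioo
    (fun x _ => by
      have := (((Real.hasDerivAt_cos x).const_sub 1).div_const 2).hasDerivWithinAt (s := Set.Ioo 0 Real.pi)
      simpa using this) hinj
    (fun x => x ^ ((a + 1) / 2 - 1) * (1 - x) ^ ((1:ℝ) / 2 - 1))
  rw [him] at hsub
  rw [hsub]
  apply MeasureTheory.setIntegral_congr_fun measurableSet_Ioo
  intro x hx
  have hs : 0 < Real.sin (x / 2) :=
    Real.sin_pos_of_pos_of_lt_pi (by linarith [hx.1]) (by linarith [hx.2, hx.1])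
  have hcp : 0 < Real.cos (x / 2) :=
    Real.cos_pos_of_mem_Ioo ⟨by linarith [hx.1, Real.pi_pos], by linarith [hx.2]⟩
  have e0 : Real.sin x = 2 * Real.sin (x / 2) * Real.cos (x / 2) := by
    rw [← Real.sin_two_mul]; congr 1; ring
  have e1 : Real.cos x = 2 * Real.cos (x / 2) ^ 2 - 1 := by
    rw [← Real.cos_two_mul]; congr 1; ring
  have hsc := Real.sin_sq_add_cos_sq (x / 2)
  have e2 : (1 - Real.cos x) / 2 = Real.sin (x / 2) ^ (2:ℝ) := by
    rw [e1, Real.rpow_two]; linarith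
  have e3 : 1 - Real.sin (x / 2) ^ (2:ℝ) = Real.cos (x / 2) ^ (2:ℝ) := by
    rw [Real.rpow_two, Real.rpow_two]; linarith
  simp only [smul_eq_mul]
  rw [e2, e3, ← Real.rpow_mul hs.le, ← Real.rpow_mul hcp.le,
    show (2:ℝ) * ((a + 1) / 2 - 1) = a - 1 by ring, show (2:ℝ) * (1 / 2 - 1) = -1 by norm_num,
    Real.rpow_neg_one, Real.rpow_sub_one hs.ne', e0, abs_of_pos (by positivity)]
  field_simp


lemma sinN_rel (s : ℝ) (hs : 1 ≤ s) (k : ℕ) :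
    ∫ x in (0:ℝ)..Real.pi, Real.sin (x / 2) ^ (2 * s - 2 + 2 * (k:ℝ))
      = Real.sqrt Real.pi * Real.Gamma (s - 1 / 2 + k) / Real.Gamma (s + k) := by
  rw [sinN_val _ (by have : (0:ℝ) ≤ k := Nat.cast_nonneg k
                     linarith)]
  rw [show (2 * s - 2 + 2 * (k:ℝ) + 1) / 2 = s - 1 / 2 + k by ring,
    show (2 * s - 2 + 2 * (k:ℝ)) / 2 + 1 = s + k by ring]

lemma U_rec (s : ℝ) (hs : 1 ≤ s) (k : ℕ) :
    (∫ x in (0:ℝ)..Real.pi, (Real.pi - x) ^ 2 * Real.sin (x / 2) ^ (2 * s - 2 + 2 * (k:ℝ)))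
        / (∫ x in (0:ℝ)..Real.pi, Real.sin (x / 2) ^ (2 * s - 2 + 2 * (k:ℝ)))
    - (∫ x in (0:ℝ)..Real.pi, (Real.pi - x) ^ 2 * Real.sin (x / 2) ^ (2 * s - 2 + 2 * ((k + 1 : ℕ):ℝ)))
        / (∫ x in (0:ℝ)..Real.pi, Real.sin (x / 2) ^ (2 * s - 2 + 2 * ((k + 1 : ℕ):ℝ)))
    = 2 / (s + k) ^ 2 := by
  have hk : (0:ℝ) ≤ k := Nat.cast_nonneg k
  have hpos : ∀ m : ℕ, 0 < ∫ x in (0:ℝ)..Real.pi, Real.sin (x / 2) ^ (2 * s - 2 + 2 * (m:ℝ)) := by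
    intro m
    have hm : (0:ℝ) ≤ m := Nat.cast_nonneg m
    rw [sinN_rel s hs m]
    have := Real.Gamma_pos_of_pos (show 0 < s - 1 / 2 + m by linarith)
    have := Real.Gamma_pos_of_pos (show 0 < s + m by linarith)
    have := Real.pi_pos
    positivity
  have h0 := hpos k
  have h1 := hpos (k + 1)
  have e : 2 * s - 2 + 2 * ((k + 1 : ℕ):ℝ) = (2 * s - 2 + 2 * (k:ℝ)) + 2 := by push_cast; ring
  rw [e] at h1 ⊢
  have hN := sinN_rec (2 * s - 2 + 2 * (k:ℝ)) (by linarith)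
  have hM := sinM_rec (2 * s - 2 + 2 * (k:ℝ)) (by linarith)
  generalize (∫ x in (0:ℝ)..Real.pi, Real.sin (x / 2) ^ (2 * s - 2 + 2 * (k:ℝ))) = N0 at *
  generalize (∫ x in (0:ℝ)..Real.pi, Real.sin (x / 2) ^ (2 * s - 2 + 2 * (k:ℝ) + 2)) = N1 at *
  generalize (∫ x in (0:ℝ)..Real.pi, (Real.pi - x) ^ 2 * Real.sin (x / 2) ^ (2 * s - 2 + 2 * (k:ℝ))) = M0 at *
  generalize (∫ x in (0:ℝ)..Real.pi, (Real.pi - x) ^ 2 * Real.sin (x / 2) ^ (2 * s - 2 + 2 * (k:ℝ) + 2)) = M1 at *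
  have hz : 0 < s + k := by linarith
  have hz1 : 0 < 2 * (s + k) - 1 := by linarith
  have ez : 2 * s - 2 + 2 * (k:ℝ) + 2 = 2 * (s + k) := by ring
  have ez1 : 2 * s - 2 + 2 * (k:ℝ) + 1 = 2 * (s + k) - 1 := by ring
  rw [ez, ez1] at hN hM
  generalize s + (k:ℝ) = z at *
  have eN : N0 = 2 * z * N1 / (2 * z - 1) := by field_simp; linarith
  have eM : M0 = (2 * z * M1 + 8 / (2 * z) * N1) / (2 * z - 1) := by field_simp; field_simp at hM; linarith
  rw [eN, eM]
  field_simp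
  ring

lemma jacobi_exact (α : ℝ) (hα : -1/2 ≤ α) (N : ℕ) :
    jacobiCoeff α (-1/2) (N + 1) (fun x => (Real.pi - x)^2)
      = 2 * Real.sqrt Real.pi * Real.Gamma (α + 3/2) / Real.Gamma (α + 1)
        * ((2 * N + α + 5/2) / (N + α + 3/2))
        * (Real.Gamma (α + 1 + N + 1) * (N.factorial : ℝ) ^ 2
          / ((N + 1).factorial * Real.Gamma (1/2 + N + 1) * Real.Gamma (α + 3/2 + N + 1))) := by
  obtain ⟨s, rfl⟩ : ∃ s, α = s - 3/2 := ⟨α + 3/2, by ring⟩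
  have hs : 1 ≤ s := by linarith
  have hs0 : 0 < s := by linarith
  have hcomb := comb N s hs0 _ (U_rec s hs)
  simp only [sinN_rel s hs] at hcomb
  have hint : ∫ x in (0:ℝ)..Real.pi, (Real.pi - x)^2 * jacobiP (s - 3/2) (-1/2) (N + 1) (Real.cos x) *
      Real.sin (x / 2) ^ (2 * (s - 3/2) + 1) * Real.cos (x / 2) ^ (2 * (-1/2 : ℝ) + 1)
      = Real.Gamma (s - 3/2 + (N + 1 : ℕ) + 1) / ((N + 1).factorial * Real.Gamma (s + N)) *
        (Real.sqrt Real.pi * ∑ k ∈ Finset.range (N + 1 + 1), (-1 : ℝ) ^ k * ((N + 1).choose k) *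
      (ascPochhammer ℝ N).eval (s + k) * 
      ((∫ x in (0:ℝ)..Real.pi, (Real.pi - x) ^ 2 * Real.sin (x / 2) ^ (2 * s - 2 + 2 * (k:ℝ)))
        / (Real.sqrt Real.pi * Real.Gamma (s - 1 / 2 + k) / Real.Gamma (s + k)))) := by
    have hcongr : ∫ x in (0:ℝ)..Real.pi, (Real.pi - x)^2 * jacobiP (s - 3/2) (-1/2) (N + 1) (Real.cos x) *
      Real.sin (x / 2) ^ (2 * (s - 3/2) + 1) * Real.cos (x / 2) ^ (2 * (-1/2 : ℝ) + 1)
      = ∫ x in (0:ℝ)..Real.pi, ∑ k ∈ Finset.range (N + 1 + 1),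
        (Real.Gamma (s - 3/2 + (N + 1 : ℕ) + 1) / ((N + 1).factorial * Real.Gamma (s + N)) *
        ((N + 1).choose k * (Real.Gamma (s + k + N) / Real.Gamma (s - 1/2 + k)) * (-1) ^ k)) *
        ((Real.pi - x) ^ 2 * Real.sin (x / 2) ^ (2 * s - 2 + 2 * (k:ℝ))) := by
      apply intervalIntegral.integral_congr
      intro x hx
      rw [Set.uIcc_of_le Real.pi_pos.le] at hx
      have hsn : 0 ≤ Real.sin (x / 2) :=
        Real.sin_nonneg_of_nonneg_of_le_pi (by linarith [hx.1]) (by linarith [hx.2, Real.pi_pos])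
      have e1 : (Real.cos x - 1) / 2 = (-1) * Real.sin (x / 2) ^ 2 := by
        have h1 : Real.cos x = 2 * Real.cos (x / 2) ^ 2 - 1 := by
          rw [← Real.cos_two_mul]; congr 1; ring
        have := Real.sin_sq_add_cos_sq (x / 2)
        rw [h1]; linarith
      simp only [jacobiP]
      rw [show (2 * (-1/2 : ℝ) + 1) = 0 by norm_num, Real.rpow_zero, mul_one, e1,
        Finset.mul_sum, Finset.mul_sum, Finset.sum_mul]
      apply Finset.sum_congr rfl
      intro k _
      rw [show 2 * (s - 3/2) + 1 = 2 * s - 2 by ring,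
        Real.rpow_add_of_nonneg hsn (show 0 ≤ 2 * s - 2 by linarith) (show (0:ℝ) ≤ 2 * (k:ℝ) by positivity),
        show Real.sin (x / 2) ^ (2 * (k:ℝ)) = (Real.sin (x / 2) ^ 2) ^ k by
          rw [← pow_mul, ← Real.rpow_natCast]; congr 1; push_cast; ring, mul_pow,
        show s - 3/2 + -1/2 + ((N + 1 : ℕ):ℝ) + 1 = s + N by push_cast; ring,
        show s - 3/2 + -1/2 + ((N + 1 : ℕ):ℝ) + k + 1 = s + k + N by push_cast; ring,
        show s - 3/2 + (k:ℝ) + 1 = s - 1/2 + k by ring]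
      ring
    rw [hcongr, intervalIntegral.integral_finsetSum]
    · rw [Finset.mul_sum, Finset.mul_sum]
      apply Finset.sum_congr rfl
      intro k _
      rw [intervalIntegral.integral_const_mul, gamma_add (s + k) (by positivity) N]
      have hk : (0:ℝ) ≤ k := Nat.cast_nonneg k
      have := Real.Gamma_pos_of_pos (show 0 < s - 1 / 2 + k by linarith)
      have := Real.Gamma_pos_of_pos (show 0 < s + k by linarith)
      have := Real.Gamma_pos_of_pos (show 0 < s + N by positivity)
      have := Real.sqrt_pos.2 Real.pi_pos
      field_simp
    · intro k _
      apply Continuous.intervalIntegrable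
      apply Continuous.mul continuous_const
      apply Continuous.mul (by fun_prop)
      exact (Real.continuous_sin.comp (by fun_prop)).rpow_const
        (fun x => Or.inr (by have : (0:ℝ) ≤ k := Nat.cast_nonneg k
                             linarith))
  simp only [jacobiCoeff]
  rw [hint]
  generalize ∑ k ∈ Finset.range (N + 1 + 1), (-1 : ℝ) ^ k * ((N + 1).choose k) *
      (ascPochhammer ℝ N).eval (s + k) *
      ((∫ x in (0:ℝ)..Real.pi, (Real.pi - x) ^ 2 * Real.sin (x / 2) ^ (2 * s - 2 + 2 * (k:ℝ)))
        / (Real.sqrt Real.pi * Real.Gamma (s - 1 / 2 + k) / Real.Gamma (s + k))) = S at hcomb ⊢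
  have hsN : 0 < s + N := by positivity
  have eS : S = 2 * ((N.factorial : ℝ) ^ 2 / (ascPochhammer ℝ (N + 1)).eval s) / (s + N) := by
    rw [← hcomb]; field_simp
  have hG : (ascPochhammer ℝ (N + 1)).eval s = Real.Gamma (s + N + 1) / Real.Gamma s := by
    have := gamma_add s hs0 (N + 1)
    have hp := Real.Gamma_pos_of_pos hs0
    rw [show s + N + 1 = s + (N + 1 : ℕ) by push_cast; ring, this]; field_simp
  rw [eS, hG]
  have hN0 : (0:ℝ) ≤ N := Nat.cast_nonneg N
  rw [show ((N + 1 : ℕ):ℝ) + (s - 3/2) + -1/2 + 1 = s + N by push_cast; ring,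
    show ((N + 1 : ℕ):ℝ) + -1/2 + 1 = 1/2 + N + 1 by push_cast; ring,
    show s - 3/2 + ((N + 1 : ℕ):ℝ) + 1 = s - 3/2 + 1 + N + 1 by push_cast; ring,
    show 2 * ((N + 1 : ℕ):ℝ) + (s - 3/2) + -1/2 + 1 = 2 * N + (s - 3/2) + 5/2 by push_cast; ring,
    show (N:ℝ) + (s - 3/2) + 3/2 = s + N by ring,
    show s - 3/2 + 3/2 = s by ring]
  have := Real.Gamma_pos_of_pos (show 0 < s + N by positivity)
  have := Real.Gamma_pos_of_pos (show 0 < s + N + 1 by positivity)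
  have := Real.Gamma_pos_of_pos hs0
  have := Real.Gamma_pos_of_pos (show 0 < s - 3/2 + 1 by linarith)
  have := Real.Gamma_pos_of_pos (show (0:ℝ) < 1/2 + N + 1 by positivity)
  have : (0:ℝ) < (N + 1).factorial := by positivity
  field_simp

/-- Example 2: `n² b_n^{(α,−1/2)}((π−x)²) → 4√π Γ(α+3/2)/Γ(α+1)`. -/
theorem stmt12 (α : ℝ) (hα : -1/2 ≤ α) :
    Filter.Tendsto
      (fun n : ℕ => (n:ℝ)^2 * jacobiCoeff α (-1/2) n (fun x => (Real.pi - x)^2))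
      Filter.atTop
      (nhds (4 * Real.sqrt Real.pi * Real.Gamma (α+3/2) / Real.Gamma (α+1))) := by
  rw [← Filter.tendsto_add_atTop_iff_nat 1]
  have l1 := gamma_lim (α + 1) (by linarith)
  have l2 := gamma_lim (1/2) (by norm_num)
  have l3 := gamma_lim (α + 3/2) (by linarith)
  have t0 : Filter.Tendsto (fun n : ℕ => (1:ℝ) / n) Filter.atTop (nhds 0) :=
    tendsto_one_div_atTop_nhds_zero_nat
  have t1 : Filter.Tendsto (fun n : ℕ => (1 + 1 / (n:ℝ)) *
      ((2 + (α + 5/2) * (1 / (n:ℝ))) / (1 + (α + 3/2) * (1 / (n:ℝ)))))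
      Filter.atTop (nhds ((1 + 0) * ((2 + (α + 5/2) * 0) / (1 + (α + 3/2) * 0)))) := by
    refine (t0.const_add 1).mul (((t0.const_mul _).const_add 2).div ((t0.const_mul _).const_add 1) ?_)
    simp
  have T := ((t1.mul ((l2.mul l3).div l1 one_ne_zero)).const_mul
    (2 * Real.sqrt Real.pi * Real.Gamma (α + 3/2) / Real.Gamma (α + 1)))
  have hlim : 2 * Real.sqrt Real.pi * Real.Gamma (α + 3/2) / Real.Gamma (α + 1) *
      ((1 + 0) * ((2 + (α + 5/2) * 0) / (1 + (α + 3/2) * 0)) * (1 * 1 / 1))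
      = 4 * Real.sqrt Real.pi * Real.Gamma (α+3/2) / Real.Gamma (α+1) := by ring
  rw [hlim] at T
  refine T.congr' ?_
  filter_upwards [Filter.eventually_gt_atTop 0] with n hn
  have hn' : (0:ℝ) < n := by exact_mod_cast hn
  rw [jacobi_exact α hα n]
  have er : (n:ℝ) ^ (α + 3/2) = (n:ℝ) ^ (α + 1) * (n:ℝ) ^ (1/2 : ℝ) := by
    rw [← Real.rpow_add hn']; congr 1; ring
  have er2 : (n:ℝ) ^ (1/2 : ℝ) * (n:ℝ) ^ (1/2 : ℝ) = n := by
    rw [← Real.rpow_add hn']; norm_num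
  have hr1 : (0:ℝ) < (n:ℝ) ^ (α + 1) := by positivity
  have hr2 : (0:ℝ) < (n:ℝ) ^ (1/2 : ℝ) := by positivity
  simp only [Pi.div_apply]
  rw [er, Nat.factorial_succ]
  have g1 := Real.Gamma_pos_of_pos (show 0 < α + 1 + n + 1 by linarith)
  have g2 := Real.Gamma_pos_of_pos (show 0 < α + 3/2 + n + 1 by linarith)
  have g3 := Real.Gamma_pos_of_pos (show (0:ℝ) < 1/2 + n + 1 by linarith)
  have g4 := Real.Gamma_pos_of_pos (show 0 < α + 1 by linarith)
  have hf : (0:ℝ) < n.factorial := by positivity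
  have hd : 0 < (n:ℝ) + α + 3/2 := by linarith
  have hq : (2 + (α + 5/2) * (1 / (n:ℝ))) / (1 + (α + 3/2) * (1 / (n:ℝ)))
      = (2 * n + α + 5/2) / (n + α + 3/2) := by
    have : 0 < 1 + (α + 3/2) * (1 / (n:ℝ)) := by
      have : 0 ≤ (α + 3/2) * (1 / (n:ℝ)) := mul_nonneg (by linarith) (by positivity)
      linarith
    rw [div_eq_div_iff this.ne' hd.ne']
    field_simp
    ring
  rw [hq]
  generalize (n:ℝ) ^ (α + 1) = R at *
  generalize (n:ℝ) ^ (1/2 : ℝ) = H at *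
  generalize Real.Gamma (α + 1 + n + 1) = G1 at *
  generalize Real.Gamma (α + 3/2 + n + 1) = G2 at *
  generalize Real.Gamma (1/2 + n + 1) = G3 at *
  generalize (2 * n + α + 5/2) / (n + α + 3/2) = q at *
  generalize 2 * Real.sqrt Real.pi * Real.Gamma (α + 3/2) / Real.Gamma (α + 1) = C at *
  push_cast
  rw [← er2] at *
  field_simp
end

section
/- Let α ≥ −1/2 be a real number, β = −1/2, and define p_0(x) = (π − x)² and p_1(x) = 2π²(π − x)² − (π − x)⁴ on [0, π]. Then for every integer n ≥ 1, the Jacobi coefficients satisfy b_n^{(α,−1/2)}(p_1) = 12 · b_n^{(α,−1/2)}(p_0) · ( ∑_{k=0}^∞ 1/(n+k)² − ∑_{k=0}^∞ 1/(n+k+α+3/2)² ). -/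
open Real in
theorem jac_ibp (A : ℝ) (hA : 1 ≤ A) (f f1 f2 : ℝ → ℝ) (h1 : ∀ x, HasDerivAt f (f1 x) x)
    (h2 : ∀ x, HasDerivAt f1 (f2 x) x) (hc : Continuous f2) (hpi : f1 π = 0) :
    A ^ 2 * (∫ x in (0:ℝ)..π, f x * sin (x / 2) ^ (2 * A)) +
      (∫ x in (0:ℝ)..π, f2 x * sin (x / 2) ^ (2 * A)) =
      A * (A - 1 / 2) * ∫ x in (0:ℝ)..π, f x * sin (x / 2) ^ (2 * A - 2) := by
  have cf : Continuous f := continuous_iff_continuousAt.2 fun x => (h1 x).continuousAt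
  have cf1 : Continuous f1 := continuous_iff_continuousAt.2 fun x => (h2 x).continuousAt
  have cs : ∀ r : ℝ, 0 ≤ r → Continuous fun x : ℝ => sin (x / 2) ^ r := fun r hr =>
    (by fun_prop : Continuous fun x : ℝ => sin (x / 2)).rpow_const fun x => Or.inr hr
  have c0 := cs (2 * A) (by linarith)
  have c1 := cs (2 * A - 1) (by linarith)
  have c2 := cs (2 * A - 2) (by linarith)
  have key : ∫ x in (0:ℝ)..π, (A * (A - 1 / 2) * (f x * sin (x / 2) ^ (2 * A - 2)) -
      (A ^ 2 * (f x * sin (x / 2) ^ (2 * A)) + f2 x * sin (x / 2) ^ (2 * A))) = 0 := by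
    rw [intervalIntegral.integral_eq_sub_of_hasDerivAt_of_le (f := fun x =>
      f x * (A * sin (x / 2) ^ (2 * A - 1) * cos (x / 2)) - f1 x * sin (x / 2) ^ (2 * A))
      pi_pos.le (by fun_prop)]
    · have e1 : (0:ℝ) ^ (2 * A - 1) = 0 := zero_rpow (by linarith)
      have e2 : (0:ℝ) ^ (2 * A) = 0 := zero_rpow (by linarith)
      simp [hpi, e1, e2]
    · intro x hx
      have hs : 0 < sin (x / 2) := sin_pos_of_pos_of_lt_pi (by linarith [hx.1]) (by linarith [hx.2, hx.1])
      have hd : HasDerivAt (fun x : ℝ => x / 2) (1 / 2) x := (hasDerivAt_id x).div_const 2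
      have ds := hd.sin
      have dc := hd.cos
      have d1 := ds.rpow_const (p := 2 * A - 1) (Or.inl hs.ne')
      have d0 := ds.rpow_const (p := 2 * A) (Or.inl hs.ne')
      have := ((h1 x).mul ((d1.const_mul A).mul dc)).sub ((h2 x).mul d0)
      refine this.congr_deriv ?_
      have r1 : sin (x / 2) ^ (2 * A - 1) = sin (x / 2) ^ (2 * A - 2) * sin (x / 2) := by
        rw [← rpow_add_one hs.ne']; ring_nf
      have r0 : sin (x / 2) ^ (2 * A) = sin (x / 2) ^ (2 * A - 2) * sin (x / 2) ^ 2 := by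
        rw [← rpow_natCast, ← rpow_add hs]; norm_num
      have r2 : sin (x / 2) ^ (2 * A - 1 - 1) = sin (x / 2) ^ (2 * A - 2) := by ring_nf
      rw [r2, r1, r0]
      have cc : cos (x / 2) ^ 2 = 1 - sin (x / 2) ^ 2 := by rw [cos_sq']
      simp only [Pi.mul_apply]
      rw [r1]
      generalize sin (x / 2) ^ (2 * A - 2) = T
      linear_combination (f x * A * (2 * A - 1) * T / 2) * cc
    · exact Continuous.intervalIntegrable (by fun_prop) _ _
  rw [intervalIntegral.integral_sub, intervalIntegral.integral_add,
    intervalIntegral.integral_const_mul, intervalIntegral.integral_const_mul] at key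
  · linarith
  all_goals exact Continuous.intervalIntegrable (by fun_prop) _ _

noncomputable def jacMom (A : ℝ) (k : ℕ) : ℝ :=
  ∫ x in (0:ℝ)..Real.pi, (Real.pi - x) ^ k * Real.sin (x / 2) ^ (2 * A - 2)

theorem jacMom_succ (A : ℝ) (k : ℕ) : jacMom (A + 1) k =
    ∫ x in (0:ℝ)..Real.pi, (Real.pi - x) ^ k * Real.sin (x / 2) ^ (2 * A) := by
  unfold jacMom; ring_nf

theorem jacMom_rec0 (A : ℝ) (hA : 1 ≤ A) :
    A ^ 2 * jacMom (A + 1) 0 = A * (A - 1 / 2) * jacMom A 0 := by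
  have := jac_ibp A hA (fun x => (Real.pi - x) ^ 0) (fun _ => 0) (fun _ => 0)
    (fun x => by simpa using hasDerivAt_const x (1:ℝ)) (fun x => hasDerivAt_const x (0:ℝ))
    continuous_const rfl
  rw [jacMom_succ]; unfold jacMom
  simpa using this

theorem jacMom_rec (A : ℝ) (hA : 1 ≤ A) (k : ℕ) :
    A ^ 2 * jacMom (A + 1) (2 * k + 2) + (2 * k + 2) * (2 * k + 1) * jacMom (A + 1) (2 * k)
      = A * (A - 1 / 2) * jacMom A (2 * k + 2) := by
  have hd : ∀ x : ℝ, HasDerivAt (fun x : ℝ => Real.pi - x) (-1) x := fun x =>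
    (hasDerivAt_id x).const_sub _
  have := jac_ibp A hA (fun x => (Real.pi - x) ^ (2 * k + 2))
    (fun x => -((2 * k + 2) * (Real.pi - x) ^ (2 * k + 1)))
    (fun x => (2 * k + 2) * (2 * k + 1) * (Real.pi - x) ^ (2 * k))
    (fun x => by
      refine ((hd x).pow (2 * k + 2)).congr_deriv ?_
      push_cast; simp)
    (fun x => by
      refine (((hd x).pow (2 * k + 1)).const_mul (2 * (k:ℝ) + 2)).neg.congr_deriv ?_
      push_cast; simp; ring)
    (by fun_prop) (by simp)
  rw [jacMom_succ, jacMom_succ]; unfold jacMom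
  rw [← this]
  congr 1
  rw [← intervalIntegral.integral_const_mul]
  simp only [mul_assoc]

theorem jacMom_pos (A : ℝ) (hA : 1 ≤ A) : 0 < jacMom A 0 := by
  unfold jacMom
  apply intervalIntegral.intervalIntegral_pos_of_pos_on
  · apply Continuous.intervalIntegrable
    have : Continuous fun x : ℝ => Real.sin (x / 2) ^ (2 * A - 2) :=
      (by fun_prop : Continuous fun x : ℝ => Real.sin (x / 2)).rpow_const
        fun x => Or.inr (by linarith)
    fun_prop
  · intro x hx
    have hs : 0 < Real.sin (x / 2) :=
      Real.sin_pos_of_pos_of_lt_pi (by linarith [hx.1]) (by linarith [hx.2, hx.1])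
    simp only [pow_zero, one_mul]
    positivity
  · exact Real.pi_pos

theorem jacMom_two_nonneg (A : ℝ) : 0 ≤ jacMom A 2 := by
  unfold jacMom
  apply intervalIntegral.integral_nonneg Real.pi_pos.le
  intro x hx
  have hs : 0 ≤ Real.sin (x / 2) :=
    Real.sin_nonneg_of_nonneg_of_le_pi (by linarith [hx.1]) (by linarith [hx.2, hx.1])
  positivity

theorem jacMom_two_le (A : ℝ) (hA : 1 ≤ A) :
    jacMom A 2 ≤ Real.pi ^ 2 * (jacMom A 0 - jacMom (A + 1) 0) := by
  rw [jacMom_succ]; unfold jacMom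
  have cs : ∀ r : ℝ, 0 ≤ r → Continuous fun x : ℝ => Real.sin (x / 2) ^ r := fun r hr =>
    (by fun_prop : Continuous fun x : ℝ => Real.sin (x / 2)).rpow_const fun x => Or.inr hr
  have c0 := cs (2 * A) (by linarith)
  have c2 := cs (2 * A - 2) (by linarith)
  rw [← intervalIntegral.integral_sub, ← intervalIntegral.integral_const_mul]
  · apply intervalIntegral.integral_mono_on_of_le_Ioo Real.pi_pos.le
    · exact Continuous.intervalIntegrable (by fun_prop) _ _
    · exact Continuous.intervalIntegrable (by fun_prop) _ _
    · intro x hx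
      have hs : 0 < Real.sin (x / 2) :=
        Real.sin_pos_of_pos_of_lt_pi (by linarith [hx.1]) (by linarith [hx.2, hx.1])
      have r0 : Real.sin (x / 2) ^ (2 * A) =
          Real.sin (x / 2) ^ (2 * A - 2) * Real.sin (x / 2) ^ 2 := by
        rw [← Real.rpow_natCast, ← Real.rpow_add hs]; norm_num
      rw [r0]
      have cc : Real.cos (x / 2) ^ 2 = 1 - Real.sin (x / 2) ^ 2 := by rw [Real.cos_sq']
      have hj := Real.mul_le_sin (x := (Real.pi - x) / 2) (by linarith [hx.2]) (by linarith [hx.1])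
      have e : Real.sin ((Real.pi - x) / 2) = Real.cos (x / 2) := by
        rw [← Real.sin_pi_div_two_sub]; ring_nf
      rw [e] at hj
      have h3 : Real.pi - x ≤ Real.pi * Real.cos (x / 2) := by
        have := mul_le_mul_of_nonneg_left hj Real.pi_pos.le
        have e2 : Real.pi * (2 / Real.pi * ((Real.pi - x) / 2)) = Real.pi - x := by
          field_simp
        linarith
      have h4 : (Real.pi - x) ^ 2 ≤ (Real.pi * Real.cos (x / 2)) ^ 2 :=
        pow_le_pow_left₀ (by linarith [hx.2]) h3 2
      have hT : 0 < Real.sin (x / 2) ^ (2 * A - 2) := by positivity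
      rw [mul_pow, cc] at h4
      nlinarith [mul_le_mul_of_nonneg_right h4 hT.le]
  all_goals exact Continuous.intervalIntegrable (by fun_prop) _ _

theorem jacMom_ratio_step (A : ℝ) (hA : 1 ≤ A) :
    jacMom A 2 / jacMom A 0 / 2 =
      1 / A ^ 2 + jacMom (A + 1) 2 / jacMom (A + 1) 0 / 2 := by
  have h0 := jacMom_rec0 A hA
  have h2 := jacMom_rec A hA 0
  norm_num at h2
  have p0 := jacMom_pos A hA
  have p1 := jacMom_pos (A + 1) (by linarith)
  have hA0 : A ≠ 0 := by linarith
  have hA1 : A - 1 / 2 ≠ 0 := by linarith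
  have e1 : jacMom A 2 = (A ^ 2 * jacMom (A + 1) 2 + 2 * jacMom (A + 1) 0) / (A * (A - 1 / 2)) := by
    rw [eq_div_iff (mul_ne_zero hA0 hA1)]; linarith
  have e0 : jacMom A 0 = (A ^ 2 * jacMom (A + 1) 0) / (A * (A - 1 / 2)) := by
    rw [eq_div_iff (mul_ne_zero hA0 hA1)]; linarith
  rw [e1, e0, div_div_div_cancel_right₀ (mul_ne_zero hA0 hA1)]
  field_simp
  ring

theorem jacMom_ratio_sum (A : ℝ) (hA : 1 ≤ A) (N : ℕ) :
    jacMom A 2 / jacMom A 0 / 2 =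
      ∑ i ∈ Finset.range N, 1 / (A + i) ^ 2 + jacMom (A + N) 2 / jacMom (A + N) 0 / 2 := by
  induction N with
  | zero => simp
  | succ N ih =>
    rw [ih, Finset.sum_range_succ, jacMom_ratio_step (A + N) (by
      have : (0:ℝ) ≤ N := Nat.cast_nonneg N
      linarith)]
    push_cast
    rw [add_assoc A]; ring

theorem jacMom_ratio_le (A : ℝ) (hA : 1 ≤ A) :
    jacMom A 2 / jacMom A 0 / 2 ≤ Real.pi ^ 2 / 4 / A := by
  have h0 := jacMom_rec0 A hA
  have p0 := jacMom_pos A hA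
  have h := jacMom_two_le A hA
  have e : jacMom (A + 1) 0 = jacMom A 0 - jacMom A 0 / (2 * A) := by
    have hA0 : A ≠ 0 := by linarith
    field_simp
    have : A * (A * jacMom (A + 1) 0) = A * ((A - 1 / 2) * jacMom A 0) := by linarith
    have := mul_left_cancel₀ hA0 this
    linarith
  rw [e] at h
  rw [div_div, div_le_iff₀ (by positivity)]
  refine h.trans (le_of_eq ?_)
  field_simp
  ring

theorem jacMom_ratio_tsum (A : ℝ) (hA : 1 ≤ A) :
    HasSum (fun k : ℕ => 1 / (A + k) ^ 2) (jacMom A 2 / jacMom A 0 / 2) := by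
  rw [hasSum_iff_tendsto_nat_of_nonneg (fun i => by positivity)]
  have hN : ∀ N : ℕ, 1 ≤ A + N := fun N => by
    have : (0:ℝ) ≤ N := Nat.cast_nonneg N
    linarith
  have hl : Filter.Tendsto (fun N : ℕ => jacMom (A + N) 2 / jacMom (A + N) 0 / 2)
      Filter.atTop (nhds 0) := by
    refine squeeze_zero (fun N => ?_) (fun N => jacMom_ratio_le _ (hN N)) ?_
    · have := jacMom_pos _ (hN N)
      have := jacMom_two_nonneg (A + N)
      positivity
    · apply Filter.Tendsto.const_div_atTop
      exact Filter.tendsto_atTop_add_const_left _ _ tendsto_natCast_atTop_atTop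
  have : (fun N : ℕ => ∑ i ∈ Finset.range N, 1 / (A + (i:ℝ)) ^ 2) =
      fun N : ℕ => jacMom A 2 / jacMom A 0 / 2 - jacMom (A + N) 2 / jacMom (A + N) 0 / 2 := by
    funext N
    rw [jacMom_ratio_sum A hA N]; ring
  rw [this]
  simpa using hl.const_sub (jacMom A 2 / jacMom A 0 / 2)

/-- Rising factorial. -/
noncomputable def jacRise (a : ℝ) (k : ℕ) : ℝ := ∏ i ∈ Finset.range k, (a + i)

theorem jacRise_succ (a : ℝ) (k : ℕ) : jacRise a (k + 1) = jacRise a k * (a + k) :=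
  Finset.prod_range_succ _ _

theorem jacRise_succ' (a : ℝ) (k : ℕ) : jacRise a (k + 1) = a * jacRise (a + 1) k := by
  unfold jacRise
  rw [Finset.prod_range_succ', mul_comm]
  push_cast
  congr 1
  · simp
  · apply Finset.prod_congr rfl; intros; ring

theorem jacRise_pos (a : ℝ) (ha : 0 < a) (k : ℕ) : 0 < jacRise a k :=
  Finset.prod_pos fun i _ => by positivity

theorem jac_gamma (a : ℝ) (ha : 0 < a) (k : ℕ) :
    Real.Gamma (a + k) = jacRise a k * Real.Gamma a := by
  induction k with
  | zero => simp [jacRise]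
  | succ k ih =>
    push_cast
    rw [← add_assoc, Real.Gamma_add_one (by positivity), ih, jacRise_succ]; ring

open PowerSeries in
/-- The factor `(A+i)^2 - u`. -/
noncomputable def jacD (A : ℝ) (i : ℕ) : PowerSeries ℝ := C ((A + i) ^ 2) - X

open PowerSeries in
noncomputable def jacF (A : ℝ) (n k : ℕ) : PowerSeries ℝ :=
  C ((-1) ^ k * (n.choose k : ℝ) * jacRise (n + A - 1) k * jacRise A k) *
    ∏ i ∈ Finset.Ico k n, jacD A i

open PowerSeries in
theorem jac_wz (A : ℝ) (n m : ℕ) (hm : m ≤ n) :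
    ∑ k ∈ Finset.range (m + 1), (jacF A (n + 1) k - (C ((n:ℝ) ^ 2) - X) * jacF A n k) =
      C ((-1) ^ m * (n.choose m : ℝ) * jacRise (n + A) m * jacRise A (m + 1) * (A + 2 * n)) *
        ∏ i ∈ Finset.Ico m n, jacD A i := by
  induction m with
  | zero =>
    have h2 : (C (2:ℝ) : PowerSeries ℝ) = 2 := map_ofNat C 2
    rw [Finset.sum_range_one]
    unfold jacF
    rw [Finset.prod_Ico_succ_top (Nat.zero_le n)]
    generalize ∏ i ∈ Finset.Ico 0 n, jacD A i = P
    simp [jacRise, jacD, h2]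
    ring
  | succ k ih =>
    rw [Finset.sum_range_succ, ih (by omega)]
    have hkn : k < n := by omega
    unfold jacF
    rw [Finset.prod_Ico_succ_top (by omega : k + 1 ≤ n), Finset.prod_eq_prod_Ico_succ_bot hkn]
    generalize ∏ i ∈ Finset.Ico (k + 1) n, jacD A i = P
    have e1 : jacRise (((n + 1 : ℕ) : ℝ) + A - 1) (k + 1) = jacRise (n + A) k * (n + A + k) := by
      rw [← jacRise_succ]; congr 1; push_cast; ring
    have e2 : jacRise ((n : ℝ) + A - 1) (k + 1) = (n + A - 1) * jacRise (n + A) k := by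
      rw [jacRise_succ']; congr 2; ring
    rw [e1, e2, jacRise_succ (n + A) k, jacRise_succ A (k + 1)]
    have hc : ((k:ℝ) + 1) * (n.choose (k + 1) : ℝ) = (n - k) * n.choose k := by
      have := Nat.choose_succ_right_eq n k
      have h2 : ((n.choose (k + 1) * (k + 1) : ℕ) : ℝ) = ((n.choose k * (n - k) : ℕ) : ℝ) := by
        rw [this]
      push_cast [Nat.cast_sub hkn.le] at h2
      linarith
    have hc' := congrArg (C : ℝ → PowerSeries ℝ) hc
    rw [Nat.choose_succ_succ]
    unfold jacD
    push_cast
    generalize (n.choose (k + 1) : ℝ) = c' at *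
    generalize (n.choose k : ℝ) = c at *
    generalize jacRise A (k + 1) = q
    generalize jacRise ((n : ℝ) + A) k = p
    simp only [map_mul, map_add, map_sub, map_pow, map_neg, map_one, pow_succ] at hc' ⊢
    have hk0 : (C (k:ℝ) + 1 : PowerSeries ℝ) ≠ 0 := by
      intro h
      have := congrArg (PowerSeries.constantCoeff (R := ℝ)) h
      simp at this
      have : (0:ℝ) ≤ k := Nat.cast_nonneg k
      linarith
    have h2 : (C (2:ℝ) : PowerSeries ℝ) = 2 := map_ofNat C 2
    rw [h2]
    apply mul_left_cancel₀ hk0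
    linear_combination (-((-1) ^ k * C p * C q * P *
      ((C (n:ℝ) + C A + C (k:ℝ)) * ((C A + C (n:ℝ)) ^ 2 - X) -
        (C (n:ℝ) ^ 2 - X) * (C (n:ℝ) + C A - 1) -
        (C (n:ℝ) + C A + C (k:ℝ)) * (C A + C (k:ℝ) + 1) * (C A + 2 * C (n:ℝ))))) * hc'

open PowerSeries in
theorem jac_saal (A : ℝ) (n : ℕ) :
    ∑ k ∈ Finset.range (n + 1), jacF A n k =
      ∏ i ∈ Finset.range n, (C ((i:ℝ) ^ 2) - X : PowerSeries ℝ) := by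
  induction n with
  | zero => simp [jacF, jacRise]
  | succ n ih =>
    rw [Finset.prod_range_succ, ← ih, Finset.sum_range_succ]
    have h := jac_wz A n n le_rfl
    rw [Finset.sum_sub_distrib, ← Finset.mul_sum] at h
    have hF : jacF A (n + 1) (n + 1) =
        -(C ((-1) ^ n * (n.choose n : ℝ) * jacRise (n + A) n * jacRise A (n + 1) * (A + 2 * n)) *
        ∏ i ∈ Finset.Ico n n, jacD A i) := by
      unfold jacF
      have e1 : jacRise (((n + 1 : ℕ) : ℝ) + A - 1) (n + 1) = jacRise (n + A) n * (n + A + n) := by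
        rw [← jacRise_succ]; congr 1; push_cast; ring
      rw [e1]
      simp only [Nat.choose_self, Finset.Ico_self, Finset.prod_empty, mul_one, ← map_neg]
      congr 1
      push_cast
      ring
    rw [hF]
    linear_combination h

open PowerSeries in
noncomputable def jacJ (A : ℝ) : PowerSeries ℝ :=
  PowerSeries.mk fun k => (-1) ^ k * jacMom A (2 * k) / ((2 * k).factorial : ℝ)

open PowerSeries in
theorem jacJ_rec (A : ℝ) (hA : 1 ≤ A) :
    (C (A ^ 2) - X) * jacJ (A + 1) = C (A * (A - 1 / 2)) * jacJ A := by
  ext k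
  rw [sub_mul, map_sub, coeff_C_mul, coeff_C_mul]
  cases k with
  | zero =>
    simp only [coeff_zero_X_mul, jacJ, coeff_mk]
    simpa using jacMom_rec0 A hA
  | succ k =>
    rw [coeff_succ_X_mul]
    simp only [jacJ, coeff_mk]
    have h := jacMom_rec A hA k
    have e : ((2 * (k + 1)).factorial : ℝ) = (2 * k + 2) * (2 * k + 1) * (2 * k).factorial := by
      rw [show 2 * (k + 1) = 2 * k + 1 + 1 by ring, Nat.factorial_succ, Nat.factorial_succ]
      push_cast; ring
    rw [e, show 2 * (k + 1) = 2 * k + 2 by ring]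
    have hf : ((2 * k).factorial : ℝ) ≠ 0 := by positivity
    have h1 : (2 * (k:ℝ) + 2) ≠ 0 := by positivity
    have h2 : (2 * (k:ℝ) + 1) ≠ 0 := by positivity
    have h3 : A ^ 2 * jacMom (A + 1) (2 * k + 2) = A * (A - 1 / 2) * jacMom A (2 * k + 2) -
      (2 * k + 2) * (2 * k + 1) * jacMom (A + 1) (2 * k) := by linarith
    have h4 : (-1) ^ k * jacMom (A + 1) (2 * k) / ((2 * k).factorial : ℝ) =
        (-1) ^ k * ((2 * k + 2) * (2 * k + 1) * jacMom (A + 1) (2 * k)) /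
          ((2 * k + 2) * (2 * k + 1) * (2 * k).factorial) := by
      field_simp
    rw [h4, pow_succ]
    linear_combination ((-1) ^ k * (-1) / ((2 * k + 2) * (2 * k + 1) * ((2 * k).factorial : ℝ))) * h

open PowerSeries in
theorem jacJ_rec_iter (A : ℝ) (hA : 1 ≤ A) (k : ℕ) :
    (∏ i ∈ Finset.range k, jacD A i) * jacJ (A + k) =
      C (jacRise A k * jacRise (A - 1 / 2) k) * jacJ A := by
  induction k with
  | zero => simp [jacRise]
  | succ k ih =>
    have h := jacJ_rec (A + k) (by
      have : (0:ℝ) ≤ k := Nat.cast_nonneg k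
      linarith)
    rw [Finset.prod_range_succ, jacRise_succ, jacRise_succ]
    push_cast
    rw [← add_assoc, mul_assoc, jacD, h]
    have : (C (jacRise A k * (A + k) * (jacRise (A - 1 / 2) k * (A - 1 / 2 + k))) : PowerSeries ℝ) =
      C (jacRise A k * jacRise (A - 1 / 2) k) * C ((A + k) * (A + k - 1 / 2)) := by
      rw [← map_mul]; congr 1; ring
    rw [this]
    linear_combination C ((A + k) * (A + k - 1 / 2)) * ih

noncomputable def jacc (A : ℝ) (n k : ℕ) : ℝ :=
  (-1) ^ k * (n.choose k : ℝ) * (jacRise (n + A - 1) k / jacRise (A - 1 / 2) k)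

open PowerSeries in
theorem jac_main (A : ℝ) (hA : 1 ≤ A) (n : ℕ) :
    (∏ i ∈ Finset.range n, jacD A i) *
      (∑ k ∈ Finset.range (n + 1), C (jacc A n k) * jacJ (A + k)) =
      (∏ i ∈ Finset.range n, (C ((i:ℝ) ^ 2) - X : PowerSeries ℝ)) * jacJ A := by
  rw [← jac_saal A n, Finset.mul_sum, Finset.sum_mul]
  apply Finset.sum_congr rfl
  intro k hk
  have hk' : k ≤ n := by simpa [Nat.lt_succ_iff] using hk
  rw [← Finset.prod_range_mul_prod_Ico _ hk']
  have h := jacJ_rec_iter A hA k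
  have hp := (jacRise_pos (A - 1 / 2) (by linarith) k).ne'
  have e : (C ((-1) ^ k * (n.choose k : ℝ) * jacRise (n + A - 1) k * jacRise A k) : PowerSeries ℝ) =
      C (jacc A n k) * C (jacRise A k * jacRise (A - 1 / 2) k) := by
    rw [← map_mul]; congr 1; unfold jacc
    generalize jacRise (A - 1 / 2) k = w at *
    field_simp
  unfold jacF
  rw [e]
  linear_combination (C (jacc A n k) * ∏ i ∈ Finset.Ico k n, jacD A i) * h

open PowerSeries in
theorem jac_prod_coeff (a : ℕ → ℝ) (ha : ∀ i, a i ≠ 0) (n : ℕ) :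
    coeff 0 (∏ i ∈ Finset.range n, (C (a i) - X : PowerSeries ℝ)) = ∏ i ∈ Finset.range n, a i ∧
    coeff 1 (∏ i ∈ Finset.range n, (C (a i) - X : PowerSeries ℝ)) =
      -(∏ i ∈ Finset.range n, a i) * ∑ i ∈ Finset.range n, 1 / a i := by
  induction n with
  | zero => simp [coeff_one]
  | succ n ih =>
    obtain ⟨h0, h1⟩ := ih
    simp only [Finset.prod_range_succ, Finset.sum_range_succ, mul_sub, map_sub, coeff_mul_C,
      coeff_zero_mul_X, h0, h1, sub_zero, true_and]
    rw [show (1:ℕ) = 0 + 1 from rfl, coeff_succ_mul_X, h0]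
    have := ha n
    field_simp
    ring

noncomputable def jacM (A : ℝ) (n m : ℕ) : ℝ :=
  ∑ k ∈ Finset.range (n + 1), jacc A n k * jacMom (A + k) m

open PowerSeries in
theorem jac_moments (A : ℝ) (hA : 1 ≤ A) (n : ℕ) :
    jacM A (n + 1) 4 = 12 * jacM A (n + 1) 2 *
      (∑ i ∈ Finset.range n, 1 / ((i:ℝ) + 1) ^ 2 +
        (jacMom A 2 / jacMom A 0 / 2 - ∑ i ∈ Finset.range (n + 1), 1 / (A + i) ^ 2)) := by
  have h := jac_main A hA (n + 1)
  rw [Finset.prod_range_succ' (fun i : ℕ => (C ((i:ℝ) ^ 2) - X : PowerSeries ℝ))] at h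
  set I : PowerSeries ℝ := ∑ k ∈ Finset.range (n + 1 + 1), C (jacc A (n + 1) k) * jacJ (A + k)
    with hI
  have hIc : ∀ m, coeff m I = (-1) ^ m * jacM A (n + 1) (2 * m) / ((2 * m).factorial : ℝ) := by
    intro m
    rw [hI, map_sum, jacM, Finset.mul_sum, Finset.sum_div]
    apply Finset.sum_congr rfl
    intro k _
    rw [coeff_C_mul, jacJ, coeff_mk]; ring
  have hP := jac_prod_coeff (fun i => (A + i) ^ 2) (fun i => by positivity) (n + 1)
  have hQ := jac_prod_coeff (fun i => ((i + 1 : ℕ) : ℝ) ^ 2) (fun i => by positivity) n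
  unfold jacD at h
  set P : PowerSeries ℝ := ∏ i ∈ Finset.range (n + 1), (C ((A + (i:ℝ)) ^ 2) - X)
  set Q : PowerSeries ℝ := ∏ i ∈ Finset.range n, (C (((i + 1 : ℕ) : ℝ) ^ 2) - X)
  have hp0 : ∏ i ∈ Finset.range (n + 1), (A + (i:ℝ)) ^ 2 ≠ 0 :=
    Finset.prod_ne_zero_iff.2 fun i _ => by positivity
  set p0 := ∏ i ∈ Finset.range (n + 1), (A + (i:ℝ)) ^ 2
  set q0 := ∏ i ∈ Finset.range n, ((i + 1 : ℕ) : ℝ) ^ 2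
  have h' : P * I = -(X * (Q * jacJ A)) := by
    rw [h]; simp; ring
  have c0 := congrArg (coeff 0) h'
  have c1 := congrArg (coeff 1) h'
  have c2 := congrArg (coeff 2) h'
  rw [map_neg, coeff_mul] at c0 c1 c2
  rw [coeff_zero_X_mul] at c0
  rw [show (1:ℕ) = 0 + 1 from rfl, coeff_succ_X_mul, coeff_mul] at c1
  rw [coeff_succ_X_mul 1, coeff_mul] at c2
  have a2 : Finset.HasAntidiagonal.antidiagonal (2:ℕ) = {(0, 2), (1, 1), (2, 0)} := by decide
  rw [a2, Finset.sum_insert (by decide), Finset.sum_insert (by decide)] at c2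
  simp only [Finset.Nat.antidiagonal_succ, Finset.Nat.antidiagonal_zero, Finset.sum_cons,
    Finset.map_singleton, Finset.sum_singleton, Finset.map_cons, Function.Embedding.prodMap,
    Function.Embedding.coeFn_mk, Prod.map_apply, Function.Embedding.refl_apply, Nat.succ_eq_add_one,
    zero_add, hP.1, hP.2, hQ.1, hQ.2, one_add_one_eq_two] at c0 c1 c2
  have j0 : coeff 0 (jacJ A) = jacMom A 0 := by simp [jacJ]
  have j1 : coeff 1 (jacJ A) = - jacMom A 2 / 2 := by simp [jacJ]
  have i1 := hIc 1
  have i2 := hIc 2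
  have i0 : coeff 0 I = 0 := by
    have : p0 * coeff 0 I = 0 := by simpa using c0
    exact (mul_eq_zero.1 this).resolve_left hp0
  norm_num [Nat.factorial] at i1 i2
  rw [i0] at c1 c2
  rw [i1] at c1 c2
  rw [i2] at c2
  rw [j0] at c1 c2
  rw [j1] at c2
  have hm0 := (jacMom_pos A hA).ne'
  push_cast at c2
  generalize ∑ i ∈ Finset.range (n + 1), 1 / (A + (i:ℝ)) ^ 2 = SA at *
  generalize ∑ i ∈ Finset.range n, 1 / ((i:ℝ) + 1) ^ 2 = SH at *
  apply mul_left_cancel₀ hp0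
  have er : jacMom A 2 = (jacMom A 2 / jacMom A 0 / 2) * 2 * jacMom A 0 := by field_simp
  generalize jacMom A 2 / jacMom A 0 / 2 = r at *
  rw [er] at c2
  linear_combination 24 * c2 + 24 * (SH + r) * c1

theorem jac_int (α : ℝ) (hα : -1/2 ≤ α) (n : ℕ) (hn : 1 ≤ n) (g : ℝ → ℝ) (hg : Continuous g) :
    (∫ x in (0:ℝ)..Real.pi, g x * jacobiP α (-1/2) n (Real.cos x) *
      Real.sin (x / 2) ^ (2 * α + 1) * Real.cos (x / 2) ^ (2 * (-1/2 : ℝ) + 1)) =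
    (Real.Gamma (α + n + 1) / (n.factorial * Real.Gamma (α + (-1/2) + n + 1)) *
      (Real.Gamma (α + (-1/2) + n + 1) / Real.Gamma (α + 1))) *
    ∑ k ∈ Finset.range (n + 1), jacc (α + 3/2) n k *
      ∫ x in (0:ℝ)..Real.pi, g x * Real.sin (x / 2) ^ (2 * (α + 3/2 + k) - 2) := by
  have hn' : (1:ℝ) ≤ n := by exact_mod_cast hn
  have cs : ∀ k : ℕ, Continuous fun x : ℝ => Real.sin (x / 2) ^ (2 * (α + 3/2 + k) - 2) := fun k =>
    (by fun_prop : Continuous fun x : ℝ => Real.sin (x / 2)).rpow_const fun x => Or.inr (by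
      have : (0:ℝ) ≤ k := Nat.cast_nonneg k
      linarith)
  simp_rw [← intervalIntegral.integral_const_mul]
  rw [← intervalIntegral.integral_finsetSum, ← intervalIntegral.integral_const_mul]
  · rw [intervalIntegral.integral_of_le Real.pi_pos.le, intervalIntegral.integral_of_le Real.pi_pos.le]
    apply MeasureTheory.setIntegral_congr_fun measurableSet_Ioc
    intro x hx
    have hs : 0 < Real.sin (x / 2) :=
      Real.sin_pos_of_pos_of_lt_pi (by linarith [hx.1]) (by linarith [hx.2, hx.1])
    simp only [jacobiP]
    rw [show 2 * (-1/2 : ℝ) + 1 = 0 by norm_num, Real.rpow_zero, mul_one]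
    rw [show ∀ a b c d : ℝ, a * (b * c) * d = b * (c * (a * d)) from fun a b c d => by ring,
      mul_assoc (Real.Gamma (α + n + 1) / (n.factorial * Real.Gamma (α + (-1/2) + n + 1)))]
    congr 1
    rw [Finset.sum_mul, Finset.mul_sum]
    apply Finset.sum_congr rfl
    intro k _
    have g1 : Real.Gamma (α + (-1/2) + n + k + 1) =
        jacRise (n + (α + 3/2) - 1) k * Real.Gamma (α + (-1/2) + n + 1) := by
      rw [show α + (-1/2) + n + k + 1 = (α + (-1/2) + n + 1) + k by ring,
        jac_gamma _ (by linarith)]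
      congr 2; ring
    have g2 : Real.Gamma (α + k + 1) = jacRise (α + 3/2 - 1/2) k * Real.Gamma (α + 1) := by
      rw [show α + k + 1 = (α + 1) + k by ring, jac_gamma _ (by linarith)]
      congr 2; ring
    have hc : (Real.cos x - 1) / 2 = -(Real.sin (x / 2) ^ 2) := by
      have := Real.cos_sq' (x / 2)
      have h2 := Real.cos_two_mul (x / 2)
      rw [show 2 * (x / 2) = x by ring] at h2
      linarith
    have hr : Real.sin (x / 2) ^ (2 * (α + 3/2 + k) - 2) =
        Real.sin (x / 2) ^ (2 * α + 1) * (Real.sin (x / 2) ^ 2) ^ k := by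
      rw [← pow_mul, ← Real.rpow_natCast, ← Real.rpow_add hs]
      congr 1; push_cast; ring
    rw [g1, g2, hc, hr, neg_pow, jacc]
    have p1 := (jacRise_pos (α + 3/2 - 1/2) (by linarith) k).ne'
    have p2 := (Real.Gamma_pos_of_pos (by linarith : 0 < α + 1)).ne'
    field_simp
  · intro k _
    have := cs k
    exact Continuous.intervalIntegrable (by fun_prop) _ _

theorem jac_coeff_eq (α : ℝ) (hα : -1/2 ≤ α) (n : ℕ) (hn : 1 ≤ n) : ∃ K : ℝ,
    ∀ g : ℝ → ℝ, Continuous g → jacobiCoeff α (-1/2) n g = K *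
    ∑ k ∈ Finset.range (n + 1), jacc (α + 3/2) n k *
      ∫ x in (0:ℝ)..Real.pi, g x * Real.sin (x / 2) ^ (2 * (α + 3/2 + k) - 2) := by
  refine ⟨((2 * n + α + (-1/2) + 1) * Real.Gamma (n + α + (-1/2) + 1) /
      (Real.Gamma (n + (-1/2) + 1) * Real.Gamma (α + 1))) *
      (Real.Gamma (α + n + 1) / (n.factorial * Real.Gamma (α + (-1/2) + n + 1)) *
      (Real.Gamma (α + (-1/2) + n + 1) / Real.Gamma (α + 1))), fun g hg => ?_⟩
  unfold jacobiCoeff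
  rw [jac_int α hα n hn g hg, ← mul_assoc]

theorem stmt13 (α : ℝ) (hα : -1/2 ≤ α) (n : ℕ) (hn : 1 ≤ n) :
    jacobiCoeff α (-1/2) n
        (fun x => 2 * Real.pi^2 * (Real.pi - x)^2 - (Real.pi - x)^4) =
      12 * jacobiCoeff α (-1/2) n (fun x => (Real.pi - x)^2) *
        ((∑' k : ℕ, 1 / ((n:ℝ) + k)^2) - ∑' k : ℕ, 1 / ((n:ℝ) + k + α + 3/2)^2) := by
  obtain ⟨K, hK⟩ := jac_coeff_eq α hα n hn
  rw [hK _ (by fun_prop), hK _ (by fun_prop)]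
  obtain ⟨m, rfl⟩ : ∃ m, n = m + 1 := ⟨n - 1, by omega⟩
  have hA : 1 ≤ α + 3/2 := by linarith
  have hm := jac_moments (α + 3/2) hA m
  have e1 : (∑ k ∈ Finset.range (m + 1 + 1), jacc (α + 3/2) (m + 1) k *
      ∫ x in (0:ℝ)..Real.pi, (2 * Real.pi^2 * (Real.pi - x)^2 - (Real.pi - x)^4) *
        Real.sin (x / 2) ^ (2 * (α + 3/2 + k) - 2)) =
      2 * Real.pi ^ 2 * jacM (α + 3/2) (m + 1) 2 - jacM (α + 3/2) (m + 1) 4 := by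
    unfold jacM
    rw [Finset.mul_sum, ← Finset.sum_sub_distrib]
    apply Finset.sum_congr rfl
    intro k _
    have cs : Continuous fun x : ℝ => Real.sin (x / 2) ^ (2 * (α + 3/2 + k) - 2) :=
      (by fun_prop : Continuous fun x : ℝ => Real.sin (x / 2)).rpow_const fun x => Or.inr (by
        have : (0:ℝ) ≤ k := Nat.cast_nonneg k
        linarith)
    simp_rw [sub_mul, mul_assoc (2 * Real.pi ^ 2)]
    rw [intervalIntegral.integral_sub, intervalIntegral.integral_const_mul]
    · unfold jacMom; ring
    all_goals exact Continuous.intervalIntegrable (by fun_prop) _ _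
  rw [e1]
  have e2 : (∑ k ∈ Finset.range (m + 1 + 1), jacc (α + 3/2) (m + 1) k *
      ∫ x in (0:ℝ)..Real.pi, (Real.pi - x)^2 *
        Real.sin (x / 2) ^ (2 * (α + 3/2 + k) - 2)) = jacM (α + 3/2) (m + 1) 2 := rfl
  rw [e2]
  have s1 := (jacMom_ratio_tsum (α + 3/2) hA)
  have t1 := s1.summable.sum_add_tsum_nat_add (m + 1)
  rw [s1.tsum_eq] at t1
  have s2 := hasSum_zeta_two
  have t2 := s2.summable.sum_add_tsum_nat_add (m + 1)
  rw [s2.tsum_eq, Finset.sum_range_succ'] at t2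
  have u1 : (∑' k : ℕ, 1 / (((m + 1 : ℕ):ℝ) + k + α + 3/2)^2) =
      ∑' k : ℕ, 1 / (α + 3/2 + ((k + (m + 1) : ℕ) : ℝ)) ^ 2 := by
    congr 1; funext k; push_cast; congr 2; ring
  have u2 : (∑' k : ℕ, 1 / (((m + 1 : ℕ):ℝ) + k)^2) =
      ∑' k : ℕ, 1 / ((k + (m + 1) : ℕ) : ℝ) ^ 2 := by
    congr 1; funext k; push_cast; congr 2; ring
  rw [u1, u2, hm, ← t1]
  have u3 : ∑ i ∈ Finset.range m, 1 / ((i:ℝ) + 1) ^ 2 = ∑ i ∈ Finset.range m, 1 / ((i + 1 : ℕ):ℝ) ^ 2 := by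
    push_cast; rfl
  rw [u3]
  norm_num only [Nat.cast_zero] at t2
  have t3 : Real.pi ^ 2 = 6 * (∑ i ∈ Finset.range m, 1 / ((i + 1 : ℕ):ℝ) ^ 2 +
      ∑' k : ℕ, 1 / ((k + (m + 1) : ℕ) : ℝ) ^ 2) := by
    linarith
  rw [t3]
  ring
end
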